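/- Let n ≥ 8 and let k be an integer satisfying either 3 ≤ k ≤ ⌈n/3⌉ + 2 or ⌊2n/3⌋ − 2 ≤ k ≤ n − 3. Then the multiplicative inverse function f_inv on F_{2^n} is not kth order sum-free; that is, there exists a k-dimensional F_2-affine subspace A of F_{2^n} with ∑_{x∈A} f_inv(x) = 0. -/

import Mathlib

open Finset
set_option linter.unusedSectionVars false

/-- `L` is an additive polynomial map whose fibres have the reciprocal sums `a / w`, and whose
kernel has reciprocal sum `σ`. -/
structure RecipSums {F : Type*} [Field F] [Fintype F] [DecidableEq F] [Algebra (ZMod 2) F]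
    (L : F →ₗ[ZMod 2] F) (a σ : F) : Prop where
  ne_zero : a ≠ 0
  ker_sum : ∑ y with L y = 0, y⁻¹ = σ
  fiber_sum : ∀ w ∈ LinearMap.range L, w ≠ 0 → ∑ y with L y = w, y⁻¹ = a * w⁻¹

section
variable {F : Type*} [Field F] [Algebra (ZMod 2) F]

theorem two_eq_zero_of_algebra (F : Type*) [Field F] [Algebra (ZMod 2) F] : (2 : F) = 0 := by
  have : CharP F 2 := charP_of_injective_algebraMap' (ZMod 2) 2
  exact CharTwo.two_eq_zero

/-- The additive map `x ↦ x² + c x`. -/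
def artinSchreier (c : F) : F →ₗ[ZMod 2] F :=
  AddMonoidHom.toZModLinearMap 2
    { toFun := fun x => x ^ 2 + c * x
      map_zero' := by simp
      map_add' := fun x y => by linear_combination (x * y) * two_eq_zero_of_algebra F }

@[simp] theorem artinSchreier_apply (c x : F) : artinSchreier c x = x ^ 2 + c * x := rfl

theorem add_self_eq_zero_of_algebra (x : F) : x + x = 0 := by
  linear_combination x * two_eq_zero_of_algebra F

theorem add_eq_zero_iff_of_algebra {x y : F} : x + y = 0 ↔ x = y :=
  ⟨fun h => by linear_combination h - y * two_eq_zero_of_algebra F,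
    fun h => by rw [h, add_self_eq_zero_of_algebra]⟩

theorem artinSchreier_eq_iff {c x y : F} :
    artinSchreier c y = artinSchreier c x ↔ y = x ∨ y = x + c := by
  have : artinSchreier c y + artinSchreier c x = (y + x) * (y + (x + c)) := by
    simp only [artinSchreier_apply]
    linear_combination (-x * y) * two_eq_zero_of_algebra F
  rw [← add_eq_zero_iff_of_algebra, this, mul_eq_zero, add_eq_zero_iff_of_algebra,
    add_eq_zero_iff_of_algebra]

theorem ker_artinSchreier (c : F) : LinearMap.ker (artinSchreier c) = Submodule.span (ZMod 2) {c} := by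
  ext x
  have h := artinSchreier_eq_iff (c := c) (x := 0) (y := x)
  rw [map_zero] at h
  rw [LinearMap.mem_ker, h, Submodule.mem_span_singleton]
  constructor
  · rintro (rfl | rfl)
    · exact ⟨0, by simp⟩
    · exact ⟨1, by simp⟩
  · rintro ⟨r, rfl⟩
    fin_cases r
    · left; exact zero_smul _ _
    · right; exact (one_smul _ _).trans (zero_add _).symm

theorem finrank_ker_comp_of_le [Finite F] {L M : F →ₗ[ZMod 2] F}
    (h : LinearMap.ker M ≤ LinearMap.range L) :
    Module.finrank (ZMod 2) (LinearMap.ker (M ∘ₗ L)) =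
      Module.finrank (ZMod 2) (LinearMap.ker L) + Module.finrank (ZMod 2) (LinearMap.ker M) := by
  have h1 := LinearMap.finrank_range_add_finrank_ker (L.domRestrict (LinearMap.ker (M ∘ₗ L)))
  have h2 : LinearMap.range (L.domRestrict (LinearMap.ker (M ∘ₗ L))) = LinearMap.ker M := by
    ext z
    constructor
    · rintro ⟨⟨x, hx⟩, rfl⟩
      exact hx
    · intro hz
      obtain ⟨x, rfl⟩ := h hz
      exact ⟨⟨x, hz⟩, rfl⟩
  have h3 : LinearMap.ker L ≤ LinearMap.ker (M ∘ₗ L) := LinearMap.ker_le_ker_comp _ _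
  have h4 : LinearMap.ker (L.domRestrict (LinearMap.ker (M ∘ₗ L))) =
      (LinearMap.ker L).submoduleOf (LinearMap.ker (M ∘ₗ L)) := rfl
  rw [h2, h4, (Submodule.submoduleOfEquivOfLe h3).finrank_eq] at h1
  omega

theorem finrank_ker_scale [Finite F] (L : F →ₗ[ZMod 2] F) {s : F} (hs : s ≠ 0) :
    Module.finrank (ZMod 2) (LinearMap.ker (L ∘ₗ LinearMap.mulLeft (ZMod 2) s)) =
      Module.finrank (ZMod 2) (LinearMap.ker L) := by
  have hr : LinearMap.range (LinearMap.mulLeft (ZMod 2) s) = ⊤ := by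
    rw [LinearMap.range_eq_top]
    exact fun y => ⟨s⁻¹ * y, by simp [mul_inv_cancel_left₀ hs]⟩
  have hk : LinearMap.ker (LinearMap.mulLeft (ZMod 2) s) = ⊥ := by
    rw [LinearMap.ker_eq_bot]
    exact fun x y h => mul_left_cancel₀ hs h
  rw [finrank_ker_comp_of_le (by rw [hr]; exact le_top), hk]
  simp

end

section
variable {F : Type*} [Field F] [Fintype F] [DecidableEq F] [Algebra (ZMod 2) F]

theorem RecipSums.id : RecipSums (LinearMap.id : F →ₗ[ZMod 2] F) 1 0 where
  ne_zero := one_ne_zero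
  ker_sum := by simp [Finset.filter_eq']
  fiber_sum := fun w _ _ => by simp [Finset.filter_eq']

theorem recipSums_artinSchreier {c : F} (hc : c ≠ 0) : RecipSums (artinSchreier c) c c⁻¹ := by
  have key : ∀ x, ∑ y with artinSchreier c y = artinSchreier c x, y⁻¹ = x⁻¹ + (x + c)⁻¹ := by
    intro x
    have : ({y | artinSchreier c y = artinSchreier c x} : Finset F) = {x, x + c} := by
      ext y; simp [-artinSchreier_apply, artinSchreier_eq_iff]
    rw [this, sum_pair]
    simpa using hc
  refine ⟨hc, ?_, ?_⟩
  · rw [← map_zero (artinSchreier c), key, inv_zero, zero_add, zero_add]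
  · rintro _ ⟨x, rfl⟩ hx
    rw [key]
    have e : artinSchreier c x = x * (x + c) := by simp only [artinSchreier_apply]; ring
    rw [e] at hx ⊢
    have h1 := left_ne_zero_of_mul hx
    have h2 := right_ne_zero_of_mul hx
    field_simp
    linear_combination x * two_eq_zero_of_algebra F

theorem RecipSums.comp {L M : F →ₗ[ZMod 2] F} {a b σ τ : F} (hL : RecipSums L a σ)
    (hM : RecipSums M b τ) (h : LinearMap.ker M ≤ LinearMap.range L) :
    RecipSums (M ∘ₗ L) (a * b) (σ + a * τ) := by
  have key : ∀ w : F, ∑ y with (M ∘ₗ L) y = w, y⁻¹ = ∑ z with M z = w, ∑ y with L y = z, y⁻¹ := by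
    intro w
    rw [← sum_fiberwise_of_maps_to (s := univ.filter fun y => (M ∘ₗ L) y = w)
      (t := univ.filter fun z => M z = w) (g := L) (by simp)]
    refine sum_congr rfl fun z hz => sum_congr ?_ fun _ _ => rfl
    ext y
    simp only [mem_filter, mem_univ, true_and, LinearMap.comp_apply] at hz ⊢
    exact ⟨fun h => h.2, fun h => ⟨by rw [h, hz], h⟩⟩
  refine ⟨mul_ne_zero hL.ne_zero hM.ne_zero, ?_, ?_⟩
  · rw [key, ← hM.ker_sum, mul_sum, ← hL.ker_sum, ← add_sum_erase _ _ (a := 0) (by simp)]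
    congr 1
    rw [← add_sum_erase (univ.filter fun z => M z = 0) (fun z => a * z⁻¹) (a := 0) (by simp)]
    simp only [inv_zero, mul_zero, zero_add]
    refine sum_congr rfl fun z hz => ?_
    simp only [mem_erase, mem_filter, mem_univ, true_and] at hz
    exact hL.fiber_sum z (h hz.2) hz.1
  · rintro _ ⟨x, rfl⟩ hx
    have hr : (M ∘ₗ L) x ∈ LinearMap.range M := ⟨L x, rfl⟩
    rw [key, mul_assoc, ← hM.fiber_sum _ hr hx, mul_sum]
    refine sum_congr rfl fun z hz => ?_
    simp only [mem_filter, mem_univ, true_and] at hz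
    refine hL.fiber_sum z ?_ ?_
    · have : z - L x ∈ LinearMap.ker M := by simp [hz]
      have := h this
      have h2 := Submodule.add_mem _ this (LinearMap.mem_range_self L x)
      simpa using h2
    · rintro rfl
      exact hx (by rw [← hz, map_zero])

theorem exists_recipSums (E : Submodule (ZMod 2) F) :
    ∃ L a σ, RecipSums L a σ ∧ LinearMap.ker L = E := by
  have key : ∀ s : Finset F, ∃ L a σ, RecipSums L a σ ∧
      LinearMap.ker L = Submodule.span (ZMod 2) (s : Set F) := by
    intro s
    induction s using Finset.induction_on with
    | empty => exact ⟨_, _, _, RecipSums.id, by simp⟩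
    | insert v s _ ih =>
      obtain ⟨L, a, σ, hL, hk⟩ := ih
      by_cases hv : L v = 0
      · refine ⟨L, a, σ, hL, ?_⟩
        rw [coe_insert, Submodule.span_insert_eq_span (hk ▸ LinearMap.mem_ker.2 hv), hk]
      · refine ⟨_, _, _, hL.comp (recipSums_artinSchreier hv) ?_, ?_⟩
        · rw [ker_artinSchreier, Submodule.span_singleton_le_iff_mem]
          exact LinearMap.mem_range_self L v
        · rw [LinearMap.ker_comp, ker_artinSchreier, coe_insert, Submodule.span_insert, ← hk,
            ← Set.image_singleton, ← Submodule.map_span, Submodule.comap_map_eq]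
  obtain ⟨L, a, σ, h, hk⟩ := key (Set.toFinite (E : Set F)).toFinset
  exact ⟨L, a, σ, h, by rw [hk]; simp⟩

/-- Some `k`-dimensional subspace has vanishing sum of reciprocals. -/
def HasRecipSumZero (F : Type*) [Field F] [Fintype F] [DecidableEq F] [Algebra (ZMod 2) F]
    (k : ℕ) : Prop :=
  ∃ (L : F →ₗ[ZMod 2] F) (a : F), RecipSums L a 0 ∧ Module.finrank (ZMod 2) (LinearMap.ker L) = k

theorem sum_inv_eq_zero {F : Type*} [Field F] [Fintype F] [Nontrivial Fˣ] : ∑ x : F, x⁻¹ = 0 := by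
  obtain ⟨c, hc⟩ := exists_ne (1 : Fˣ)
  have h : ∑ x : F, x⁻¹ = (c : F)⁻¹ * ∑ x : F, x⁻¹ := by
    rw [mul_sum, ← Equiv.sum_comp (Equiv.mulLeft₀ (c : F) c.ne_zero)]
    refine sum_congr rfl fun x _ => ?_
    simp only [Equiv.mulLeft₀_apply, mul_inv]
  have h2 : (c : F) ≠ 1 := by simpa using hc
  have h3 : ((c : F) - 1) * ∑ x : F, x⁻¹ = 0 := by
    have := congrArg (fun y => (c : F) * y) h
    simp only [mul_inv_cancel_left₀ c.ne_zero] at this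
    linear_combination this
  exact (mul_eq_zero.1 h3).resolve_left (sub_ne_zero.2 h2)

theorem HasRecipSumZero.dual {k : ℕ} [Nontrivial Fˣ] (h : HasRecipSumZero F k) :
    HasRecipSumZero F (Module.finrank (ZMod 2) F - k) := by
  obtain ⟨L, a, hL, hk⟩ := h
  obtain ⟨M, b, τ, hM, hMk⟩ := exists_recipSums (LinearMap.range L)
  have hc := hL.comp hM hMk.le
  have h0 : M ∘ₗ L = 0 := by
    ext x
    exact LinearMap.mem_ker.1 (hMk.ge (LinearMap.mem_range_self L x))
  have h1 := hc.ker_sum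
  rw [h0] at h1
  simp only [LinearMap.zero_apply, filter_true, sum_inv_eq_zero, zero_add] at h1
  have hτ : τ = 0 := (mul_eq_zero.1 h1.symm).resolve_left hL.ne_zero
  refine ⟨M, b, hτ ▸ hM, ?_⟩
  rw [hMk, ← LinearMap.finrank_range_add_finrank_ker L, hk]
  omega

theorem RecipSums.scale {L : F →ₗ[ZMod 2] F} {a σ s : F} (hL : RecipSums L a σ) (hs : s ≠ 0) :
    RecipSums (L ∘ₗ LinearMap.mulLeft (ZMod 2) s) (s * a) (s * σ) := by
  have key : ∀ w, ∑ y with (L ∘ₗ LinearMap.mulLeft (ZMod 2) s) y = w, y⁻¹ =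
      s * ∑ y with L y = w, y⁻¹ := by
    intro w
    rw [mul_sum]
    refine sum_bij (fun y hy => s * y) ?_ (fun _ _ _ _ h => mul_left_cancel₀ hs h) ?_ ?_
    · intro y hy
      rw [mem_filter] at hy ⊢
      exact ⟨mem_univ _, hy.2⟩
    · intro y hy
      refine ⟨s⁻¹ * y, ?_, by field_simp⟩
      rw [mem_filter] at hy ⊢
      refine ⟨mem_univ _, ?_⟩
      rw [LinearMap.comp_apply, LinearMap.mulLeft_apply, mul_inv_cancel_left₀ hs, hy.2]
    · intro y _
      rw [mul_inv, mul_inv_cancel_left₀ hs]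
  refine ⟨mul_ne_zero hs hL.ne_zero, by rw [key, hL.ker_sum], ?_⟩
  rintro _ ⟨x, rfl⟩ hx
  rw [key, hL.fiber_sum ((L ∘ₗ LinearMap.mulLeft (ZMod 2) s) x) ⟨s * x, rfl⟩ hx, mul_assoc]

theorem HasRecipSumZero.add {d j : ℕ} (hd : HasRecipSumZero F d) (hj : HasRecipSumZero F j)
    (h : d * j < Module.finrank (ZMod 2) F) : HasRecipSumZero F (d + j) := by
  obtain ⟨L, a, hL, hLd⟩ := hd
  obtain ⟨M, b, hM, hMj⟩ := hj
  let R := LinearMap.range L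
  let φ : F →ₗ[ZMod 2] (LinearMap.ker M →ₗ[ZMod 2] F ⧸ R) :=
    { toFun := fun s => R.mkQ ∘ₗ LinearMap.mulLeft (ZMod 2) s ∘ₗ (LinearMap.ker M).subtype
      map_add' := fun s t => by ext x; simp [add_mul]
      map_smul' := fun r s => by ext x; simp }
  have hφ : LinearMap.ker φ ≠ ⊥ := by
    apply LinearMap.ker_ne_bot_of_finrank_lt
    rw [Module.finrank_linearMap, hMj]
    have h1 := LinearMap.finrank_range_add_finrank_ker L
    have h2 := Submodule.finrank_quotient_add_finrank R
    have h3 : Module.finrank (ZMod 2) (F ⧸ R) = d := by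
      change Module.finrank (ZMod 2) R + _ = _ at h1
      omega
    rw [h3, mul_comm]
    exact h
  obtain ⟨s, hs, hs0⟩ := Submodule.exists_mem_ne_zero_of_ne_bot hφ
  have hle : LinearMap.ker (M ∘ₗ LinearMap.mulLeft (ZMod 2) s⁻¹) ≤ LinearMap.range L := by
    intro x hx
    have := congrArg (fun f => f ⟨s⁻¹ * x, hx⟩) (LinearMap.mem_ker.1 hs)
    simpa [φ, mul_inv_cancel_left₀ hs0, R] using this
  have := hL.comp (hM.scale (inv_ne_zero hs0)) hle
  rw [mul_zero, mul_zero, add_zero] at this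
  refine ⟨_, _, this, (finrank_ker_comp_of_le hle).trans ?_⟩
  rw [finrank_ker_scale _ (inv_ne_zero hs0), hLd, hMj]

end

section
variable {F : Type*} [Field F] [Fintype F] [DecidableEq F] [Algebra (ZMod 2) F]

/-- The canonical additive character of a finite field of characteristic two, as a sign. -/
noncomputable def traceSign (x : F) : ℤ := if Algebra.trace (ZMod 2) F x = 0 then 1 else -1

theorem traceSign_add (x y : F) : traceSign (x + y) = traceSign x * traceSign y := by
  unfold traceSign
  rw [map_add]
  generalize Algebra.trace (ZMod 2) F x = r
  generalize Algebra.trace (ZMod 2) F y = s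
  revert r s
  decide

@[simp] theorem traceSign_zero : traceSign (0 : F) = 1 := by simp [traceSign]

theorem traceSign_mul_self (x : F) : traceSign x * traceSign x = 1 := by
  unfold traceSign; split_ifs <;> norm_num

theorem trace_sq (x : F) : Algebra.trace (ZMod 2) F (x ^ 2) = Algebra.trace (ZMod 2) F x := by
  have : CharP F 2 := charP_of_injective_algebraMap' (ZMod 2) 2
  have h := Algebra.trace_eq_of_algEquiv (FiniteField.frobeniusAlgEquiv (ZMod 2) F 2) x
  simpa using h

theorem traceSign_sq (x : F) : traceSign (x ^ 2) = traceSign x := by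
  unfold traceSign; rw [trace_sq]

theorem exists_traceSign_eq_neg_one {a : F} (ha : a ≠ 0) : ∃ x : F, traceSign (a * x) = -1 := by
  by_contra! h
  have h0 : ∀ x, Algebra.trace (ZMod 2) F (a * x) = 0 := by
    intro x
    by_contra hx
    exact h x (by simp [traceSign, hx])
  exact ha (by
    have := (traceForm_nondegenerate (ZMod 2) F).1 a
    exact this fun x => by simpa [Algebra.traceForm_apply] using h0 x)

theorem sum_traceSign_mul {a : F} (ha : a ≠ 0) : ∑ x, traceSign (a * x) = 0 := by
  obtain ⟨c, hc⟩ := exists_traceSign_eq_neg_one ha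
  have h : ∑ x, traceSign (a * x) = ∑ x, traceSign (a * (x + c)) :=
    (Equiv.sum_comp (Equiv.addRight c) fun x => traceSign (a * x)).symm
  simp only [mul_add, traceSign_add, hc, ← sum_mul] at h
  omega

theorem sum_traceSign_mul_eq (a : F) :
    ∑ x, traceSign (a * x) = if a = 0 then (Fintype.card F : ℤ) else 0 := by
  split_ifs with h
  · simp [h]
  · exact sum_traceSign_mul h

/-- Additive Hilbert 90. -/
theorem exists_sq_add_self_eq {c : F} (hc : traceSign c = 1) : ∃ m : F, m ^ 2 + m = c := by
  have hle : LinearMap.range (artinSchreier (1 : F)) ≤ LinearMap.ker (Algebra.trace (ZMod 2) F) := by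
    rintro _ ⟨x, rfl⟩
    rw [LinearMap.mem_ker, artinSchreier_apply, one_mul, map_add, trace_sq]
    exact CharTwo.add_self_eq_zero _
  have h1 := LinearMap.finrank_range_add_finrank_ker (artinSchreier (1 : F))
  have h2 := LinearMap.finrank_range_add_finrank_ker (Algebra.trace (ZMod 2) F)
  rw [ker_artinSchreier, finrank_span_singleton one_ne_zero] at h1
  rw [LinearMap.range_eq_top.2 (Algebra.trace_surjective (ZMod 2) F), finrank_top,
    Module.finrank_self] at h2
  have heq := Submodule.eq_of_le_of_finrank_eq hle (by omega)
  have hmem : c ∈ LinearMap.ker (Algebra.trace (ZMod 2) F) := by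
    rw [LinearMap.mem_ker]
    by_contra h
    simp [traceSign, h] at hc
  rw [← heq] at hmem
  obtain ⟨m, hm⟩ := hmem
  exact ⟨m, by simpa using hm⟩

theorem card_sq_add_self_eq (c : F) :
    ((#{m : F | m ^ 2 + m = c} : ℕ) : ℤ) = 1 + traceSign c := by
  by_cases hc : traceSign c = 1
  · obtain ⟨m, rfl⟩ := exists_sq_add_self_eq hc
    have : ({x : F | x ^ 2 + x = m ^ 2 + m} : Finset F) = {m, m + 1} := by
      ext x
      simpa using artinSchreier_eq_iff (c := 1) (x := m) (y := x)
    rw [this, card_pair (by simp), hc]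
    norm_num
  · have h1 : traceSign c = -1 := by
      unfold traceSign at hc ⊢
      split_ifs at hc ⊢ <;> simp_all
    rw [h1, card_eq_zero.2]
    · simp
    · rw [filter_eq_empty_iff]
      rintro m - rfl
      rw [traceSign_add, traceSign_sq, traceSign_mul_self] at h1
      norm_num at h1

/-- Binary Kloosterman sum, with the convention `0⁻¹ = 0`. -/
noncomputable def kloosterman (a : F) : ℤ := ∑ x, traceSign (a * x + x⁻¹)

theorem kloosterman_zero : kloosterman (0 : F) = 0 := by
  have h := sum_traceSign_mul (one_ne_zero (α := F))
  rw [← h, kloosterman, ← (inv_involutive (G := F)).bijective.sum_comp]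
  simp

theorem sqrt_exists (F : Type*) [Field F] [Finite F] [Algebra (ZMod 2) F] :
    Function.Bijective fun x : F => x ^ 2 := by
  rw [← Finite.injective_iff_bijective]
  intro x y h
  have h2 := two_eq_zero_of_algebra F
  have : (x - y) ^ 2 = 0 := by
    simp only at h
    linear_combination h + (y ^ 2 - x * y) * h2
  exact sub_eq_zero.1 (pow_eq_zero_iff two_ne_zero |>.1 this)

theorem kloosterman_sq (a : F) : kloosterman (a ^ 2) = kloosterman a := by
  unfold kloosterman
  rw [← Function.Bijective.sum_comp (sqrt_exists F)]
  refine sum_congr rfl fun x _ => ?_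
  rw [← traceSign_sq (a * x + x⁻¹)]
  congr 1
  rw [← inv_pow]
  linear_combination (- a * x * x⁻¹) * two_eq_zero_of_algebra F

theorem sum_kloosterman_sq : ∑ a : F, kloosterman a ^ 2 = (Fintype.card F : ℤ) ^ 2 := by
  have h : ∀ a : F, kloosterman a ^ 2 =
      ∑ x : F, ∑ y : F, traceSign (x⁻¹ + y⁻¹) * traceSign ((x + y) * a) := by
    intro a
    rw [sq, kloosterman, sum_mul_sum]
    refine sum_congr rfl fun x _ => sum_congr rfl fun y _ => ?_
    rw [← traceSign_add, ← traceSign_add]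
    congr 1
    ring
  simp only [h]
  rw [sum_comm]
  have h2 : ∀ x : F, ∑ a : F, ∑ y : F, traceSign (x⁻¹ + y⁻¹) * traceSign ((x + y) * a) =
      Fintype.card F := by
    intro x
    rw [sum_comm]
    simp only [← mul_sum, sum_traceSign_mul_eq, add_eq_zero_iff_of_algebra]
    simp [add_self_eq_zero_of_algebra]
  simp [h2, sq]

theorem kloosterman_one_sq :
    kloosterman (1 : F) ^ 2 - 2 * kloosterman (1 : F) =
      ∑ t ∈ (univ : Finset F) \ {0, 1}, kloosterman (t + t⁻¹) := by
  have hsplit : ∀ f : F → ℤ, ∑ t, f t = f 0 + f 1 + ∑ t ∈ (univ : Finset F) \ {0, 1}, f t := by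
    intro f
    rw [← sum_sdiff (subset_univ ({0, 1} : Finset F)), sum_pair zero_ne_one]
    ring
  have hnz : ∀ a : F, ∑ x ∈ univ.erase (0 : F), traceSign (a * x + x⁻¹) = kloosterman a - 1 := by
    intro a
    rw [kloosterman, ← add_sum_erase univ _ (mem_univ (0 : F))]
    simp
  have h1 : kloosterman (1 : F) ^ 2 =
      kloosterman (1 : F) + ∑ t : F, ∑ x ∈ univ.erase (0 : F),
        traceSign ((1 + t) * x + (1 + t⁻¹) * x⁻¹) := by
    rw [sq]
    nth_rewrite 1 [kloosterman]
    rw [sum_mul, ← add_sum_erase univ _ (mem_univ (0 : F))]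
    congr 1
    · simp
    · rw [sum_comm]
      refine sum_congr rfl fun x hx => ?_
      have hx0 := ne_of_mem_erase hx
      rw [kloosterman, ← Equiv.sum_comp (Equiv.mulLeft₀ x hx0), mul_sum]
      refine sum_congr rfl fun t _ => ?_
      rw [← traceSign_add]
      congr 1
      simp only [Equiv.mulLeft₀_apply, mul_inv]
      ring
  have h2 : ∀ t ∈ (univ : Finset F) \ {0, 1},
      ∑ x ∈ univ.erase (0 : F), traceSign ((1 + t) * x + (1 + t⁻¹) * x⁻¹) =
        kloosterman (t + t⁻¹) - 1 := by
    intro t ht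
    simp only [mem_sdiff, mem_univ, mem_insert, mem_singleton, not_or, true_and] at ht
    have hc : (1 + t⁻¹) ≠ 0 := by
      rw [Ne, add_eq_zero_iff_of_algebra]
      intro h
      exact ht.2 (by rw [← inv_inv t, ← h, inv_one])
    rw [← hnz]
    refine sum_bij' (fun x _ => (1 + t⁻¹)⁻¹ * x) (fun x _ => (1 + t⁻¹) * x) ?_ ?_ ?_ ?_ ?_
    · intro x hx
      simpa [hc] using hx
    · intro x hx
      simpa [hc] using hx
    · intro x _; exact mul_inv_cancel_left₀ hc x
    · intro x _; exact inv_mul_cancel_left₀ hc x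
    · intro x _
      congr 1
      rw [mul_inv, inv_inv]
      congr 1
      have : t + t⁻¹ = (1 + t) * (1 + t⁻¹) := by
        have := ht.1
        field_simp
        linear_combination (-t) * two_eq_zero_of_algebra F
      rw [this, mul_assoc, mul_inv_cancel_left₀ hc]
  rw [h1, hsplit, sum_congr rfl h2]
  have h3 : ∑ x ∈ univ.erase (0 : F), traceSign ((1 + 0) * x + (1 + (0 : F)⁻¹) * x⁻¹) =
      kloosterman (1 : F) - 1 := by
    rw [← hnz]
    simp
  have h4 : ∑ x ∈ univ.erase (0 : F), traceSign ((1 + 1) * x + (1 + (1 : F)⁻¹) * x⁻¹) =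
      Fintype.card F - 1 := by
    simp [add_self_eq_zero_of_algebra, Fintype.card_pos]
  rw [h3, h4]
  simp only [sum_sub_distrib, sum_const, nsmul_eq_mul, mul_one]
  have h5 : ((#((univ : Finset F) \ {0, 1}) : ℕ) : ℤ) = Fintype.card F - 2 := by
    rw [card_sdiff_of_subset (subset_univ _), card_pair zero_ne_one, card_univ,
      Nat.cast_sub Fintype.one_lt_card]
    rfl
  rw [h5]
  ring

theorem kloosterman_one_bound :
    (kloosterman (1 : F) ^ 2 - 2 * kloosterman (1 : F)) ^ 2 ≤ 2 * (Fintype.card F : ℤ) ^ 3 := by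
  rw [kloosterman_one_sq]
  refine (sq_sum_le_card_mul_sum_sq).trans ?_
  have h1 : ∑ t ∈ (univ : Finset F) \ {0, 1}, kloosterman (t + t⁻¹) ^ 2 ≤
      2 * (Fintype.card F : ℤ) ^ 2 := by
    rw [← sum_kloosterman_sq, mul_sum,
      ← sum_fiberwise (univ \ {0, 1}) (fun t : F => t + t⁻¹)]
    refine sum_le_sum fun a _ => ?_
    rw [sum_congr rfl (g := fun _ => kloosterman a ^ 2) fun x hx => by rw [(mem_filter.1 hx).2],
      sum_const, nsmul_eq_mul]
    refine mul_le_mul_of_nonneg_right ?_ (sq_nonneg _)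
    norm_cast
    rcases Finset.eq_empty_or_nonempty ({t ∈ univ \ {0, 1} | t + t⁻¹ = a} : Finset F) with h | ⟨t, ht⟩
    · rw [h]; simp
    · refine (card_le_card (t := {t, t⁻¹}) ?_).trans card_le_two
      intro x hx
      simp only [mem_filter, mem_sdiff, mem_univ, mem_insert, mem_singleton, not_or,
        true_and] at hx ht ⊢
      have hx0 := hx.1.1
      have ht0 := ht.1.1
      have h := hx.2.trans ht.2.symm
      have : (x - t) * (x * t - 1) = 0 := by
        field_simp at h
        linear_combination h
      rcases mul_eq_zero.1 this with h | h
      · exact Or.inl (sub_eq_zero.1 h)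
      · exact Or.inr (eq_inv_of_mul_eq_one_left (sub_eq_zero.1 h))
  have h2 : ((#((univ : Finset F) \ {0, 1}) : ℕ) : ℤ) ≤ Fintype.card F := by
    norm_cast
    exact card_le_univ _
  calc _ ≤ (Fintype.card F : ℤ) * (2 * (Fintype.card F : ℤ) ^ 2) :=
        mul_le_mul h2 h1 (sum_nonneg fun _ _ => sq_nonneg _) (by positivity)
    _ = _ := by ring

end

section
variable {F : Type*} [Field F] [Fintype F] [DecidableEq F] [Algebra (ZMod 2) F]

theorem RecipSums.step {L : F →ₗ[ZMod 2] F} {a σ v : F} (hL : RecipSums L a σ) (hv : L v ≠ 0) :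
    RecipSums (artinSchreier (L v) ∘ₗ L) (a * L v) (σ + a * (L v)⁻¹) ∧
      Module.finrank (ZMod 2) (LinearMap.ker (artinSchreier (L v) ∘ₗ L)) =
        Module.finrank (ZMod 2) (LinearMap.ker L) + 1 := by
  have hle : LinearMap.ker (artinSchreier (L v)) ≤ LinearMap.range L := by
    rw [ker_artinSchreier, Submodule.span_singleton_le_iff_mem]
    exact LinearMap.mem_range_self L v
  refine ⟨hL.comp (recipSums_artinSchreier hv) hle, ?_⟩
  rw [finrank_ker_comp_of_le hle, ker_artinSchreier, finrank_span_singleton hv]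

theorem finrank_ker_artinSchreier {c : F} (hc : c ≠ 0) :
    Module.finrank (ZMod 2) (LinearMap.ker (artinSchreier c)) = 1 := by
  rw [ker_artinSchreier, finrank_span_singleton hc]

theorem hasRecipSumZero_three_of_traceSign {h : F} (h0 : h ≠ 0) (h1 : h + 1 ≠ 0)
    (h2 : h ^ 2 + h ≠ 1) (hA : traceSign (1 + h⁻¹ + (h + 1)⁻¹) = 1)
    (hB : traceSign (h + (h + 1)⁻¹) = 1) : HasRecipSumZero F 3 := by
  obtain ⟨t, ht⟩ := exists_sq_add_self_eq hA
  obtain ⟨z, hz⟩ := exists_sq_add_self_eq hB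
  have two := two_eq_zero_of_algebra F
  set u := 1 + h⁻¹ + (h + 1)⁻¹ with hu
  have hue : u * (h * (h + 1)) = h ^ 2 + h + 1 := by
    rw [hu]
    field_simp
    linear_combination (h) * two
  have hu0 : u ≠ 0 := by
    intro hz
    rw [hz, zero_mul] at hue
    exact h2 (add_eq_zero_iff_of_algebra.1 hue.symm)
  have hw : h + (h + 1)⁻¹ = u * h := by
    rw [hu]
    field_simp
    linear_combination (-h) * two
  rw [hw] at hz
  have r1 := recipSums_artinSchreier (one_ne_zero (α := F))
  have e1 : artinSchreier 1 t = u := by rw [artinSchreier_apply, one_mul, ht]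
  obtain ⟨r2, d2⟩ := r1.step (v := t) (by rwa [e1])
  rw [e1] at r2 d2
  have e2 : (artinSchreier u ∘ₗ artinSchreier 1) z = u ^ 2 * (h * (h + 1)) := by
    rw [LinearMap.comp_apply, artinSchreier_apply 1 z, one_mul, hz, artinSchreier_apply]
    ring
  have hne : u ^ 2 * (h * (h + 1)) ≠ 0 :=
    mul_ne_zero (pow_ne_zero _ hu0) (mul_ne_zero h0 h1)
  obtain ⟨r3, d3⟩ := r2.step (v := z) (by rwa [e2])
  rw [e2] at r3 d3
  have e3 : (1 : F)⁻¹ + 1 * u⁻¹ + 1 * u * (u ^ 2 * (h * (h + 1)))⁻¹ = 0 := by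
    field_simp
    linear_combination hue + (h ^ 2 + h + 1) * two
  rw [e3] at r3
  refine ⟨_, _, r3, ?_⟩
  rw [d3, d2, finrank_ker_artinSchreier one_ne_zero]

theorem sum_traceSign_add_inv :
    ∑ h ∈ (univ : Finset F) \ {0, 1}, traceSign (h + h⁻¹) = kloosterman (1 : F) - 2 := by
  rw [kloosterman, ← sum_sdiff (subset_univ ({0, 1} : Finset F)), sum_pair zero_ne_one]
  simp [add_self_eq_zero_of_algebra]

theorem sum_traceSign_add_inv_add_one :
    ∑ h ∈ (univ : Finset F) \ {0, 1}, traceSign (h + (h + 1)⁻¹) =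
      traceSign (1 : F) * (kloosterman (1 : F) - 2) := by
  rw [← sum_traceSign_add_inv, mul_sum]
  refine sum_bij' (fun x _ => x + 1) (fun x _ => x + 1) ?_ ?_ ?_ ?_ ?_
  · intro x hx
    simp only [mem_sdiff, mem_univ, mem_insert, mem_singleton, not_or, true_and] at hx ⊢
    rw [add_eq_zero_iff_of_algebra]
    simpa [and_comm] using hx
  · intro x hx
    simp only [mem_sdiff, mem_univ, mem_insert, mem_singleton, not_or, true_and] at hx ⊢
    rw [add_eq_zero_iff_of_algebra]
    simpa [and_comm] using hx
  · intro x _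
    linear_combination two_eq_zero_of_algebra F
  · intro x _
    linear_combination two_eq_zero_of_algebra F
  · intro x _
    rw [← traceSign_add]
    congr 1
    linear_combination (-1) * two_eq_zero_of_algebra F

theorem sum_traceSign_one_add_inv_add_inv :
    ∑ h ∈ (univ : Finset F) \ {0, 1}, traceSign (1 + h⁻¹ + (h + 1)⁻¹) =
      traceSign (1 : F) * (kloosterman (1 : F) - 2) := by
  rw [← sum_traceSign_add_inv_add_one]
  refine sum_bij' (fun x _ => x⁻¹) (fun x _ => x⁻¹) ?_ ?_ ?_ ?_ ?_
  · simp
  · simp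
  · intro x _; exact inv_inv x
  · intro x _; exact inv_inv x
  · intro x hx
    simp only [mem_sdiff, mem_univ, mem_insert, mem_singleton, not_or, true_and] at hx
    have h1 : x + 1 ≠ 0 := by rw [Ne, add_eq_zero_iff_of_algebra]; exact hx.2
    have h0 := hx.1
    have h2 : x⁻¹ + 1 ≠ 0 := by
      intro h
      apply h1
      field_simp at h
      linear_combination h
    have h3 : 1 + x ≠ 0 := by rwa [add_comm]
    congr 1
    have : (x⁻¹ + 1)⁻¹ = 1 + (x + 1)⁻¹ := by
      field_simp
      linear_combination (-1 - x) * two_eq_zero_of_algebra F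
    rw [this]
    ring

theorem hasRecipSumZero_three (hq : 256 ≤ Fintype.card F) : HasRecipSumZero F 3 := by
  by_contra hcon
  have hS : ∑ h ∈ (univ : Finset F) \ {0, 1},
      (1 + traceSign (1 + h⁻¹ + (h + 1)⁻¹)) * (1 + traceSign (h + (h + 1)⁻¹)) =
      Fintype.card F - 2 + 3 * (traceSign (1 : F) * (kloosterman (1 : F) - 2)) := by
    have e : ∀ h : F, (1 + traceSign (1 + h⁻¹ + (h + 1)⁻¹)) * (1 + traceSign (h + (h + 1)⁻¹)) =
        1 + traceSign (1 + h⁻¹ + (h + 1)⁻¹) + traceSign (h + (h + 1)⁻¹) +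
          traceSign (1 : F) * traceSign (h + h⁻¹) := by
      intro h
      have : traceSign (1 : F) * traceSign (h + h⁻¹) =
          traceSign (1 + h⁻¹ + (h + 1)⁻¹) * traceSign (h + (h + 1)⁻¹) := by
        rw [← traceSign_add, ← traceSign_add]
        congr 1
        linear_combination (-(h + 1)⁻¹) * two_eq_zero_of_algebra F
      rw [this]
      ring
    simp only [e, sum_add_distrib, ← mul_sum]
    rw [sum_traceSign_one_add_inv_add_inv, sum_traceSign_add_inv_add_one, sum_traceSign_add_inv,
      sum_const, card_sdiff_of_subset (subset_univ _), card_pair zero_ne_one, card_univ,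
      nsmul_eq_mul, Nat.cast_sub Fintype.one_lt_card]
    push_cast
    ring
  have hsign : ∀ x : F, traceSign x = 1 ∨ traceSign x = -1 := by
    intro x; unfold traceSign; split_ifs <;> simp
  have hle : ∑ h ∈ (univ : Finset F) \ {0, 1},
      (1 + traceSign (1 + h⁻¹ + (h + 1)⁻¹)) * (1 + traceSign (h + (h + 1)⁻¹)) ≤ 8 := by
    calc _ ≤ ∑ h ∈ (univ : Finset F) \ {0, 1}, (if h ^ 2 + h = 1 then (4 : ℤ) else 0) := by
          refine sum_le_sum fun h hh => ?_
          simp only [mem_sdiff, mem_univ, mem_insert, mem_singleton, not_or, true_and] at hh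
          have h1 : h + 1 ≠ 0 := by rw [Ne, add_eq_zero_iff_of_algebra]; exact hh.2
          rcases hsign (1 + h⁻¹ + (h + 1)⁻¹) with hA | hA <;>
          rcases hsign (h + (h + 1)⁻¹) with hB | hB <;>
          by_cases h2 : h ^ 2 + h = 1 <;> simp only [hA, hB, h2, if_true, if_false] <;> norm_num
          exact hcon (hasRecipSumZero_three_of_traceSign hh.1 h1 h2 hA hB)
      _ ≤ ∑ h : F, (if h ^ 2 + h = 1 then (4 : ℤ) else 0) :=
          sum_le_sum_of_subset_of_nonneg (subset_univ _) fun _ _ _ => by split_ifs <;> norm_num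
      _ = 4 * (1 + traceSign (1 : F)) := by
          rw [← card_sq_add_self_eq, ← sum_filter, sum_const, nsmul_eq_mul, mul_comm]
      _ ≤ 8 := by rcases hsign 1 with h | h <;> rw [h] <;> norm_num
  rw [hS] at hle
  have hb := kloosterman_one_bound (F := F)
  generalize kloosterman (1 : F) = K at hb hle
  have hq' : (256 : ℤ) ≤ Fintype.card F := by exact_mod_cast hq
  generalize (Fintype.card F : ℤ) = q at hb hle hq'
  have hK : q - 16 ≤ 3 * |K| := by
    have h1 := neg_abs_le K
    have h2 := le_abs_self K
    rcases hsign 1 with h | h <;> rw [h] at hle <;> linarith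
  have h3 : |K| * (|K| - 2) ≤ K ^ 2 - 2 * K := by
    nlinarith [sq_abs K, le_abs_self K]
  have h4 : (q - 16) * (q - 22) ≤ 9 * (K ^ 2 - 2 * K) := by nlinarith
  have h5 : ((q - 16) * (q - 22)) ^ 2 ≤ 81 * (K ^ 2 - 2 * K) ^ 2 := by
    have : 0 ≤ (q - 16) * (q - 22) := mul_nonneg (by linarith) (by linarith)
    nlinarith
  obtain ⟨r, rfl⟩ : ∃ r, q = 256 + r := ⟨q - 256, by ring⟩
  have hr : 0 ≤ r := by linarith
  have : 0 ≤ r ^ 2 := by positivity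
  have : 0 ≤ r ^ 3 := by positivity
  have : 0 ≤ r ^ 4 := by positivity
  nlinarith

end

section
variable {F : Type*} [Field F] [Fintype F] [DecidableEq F] [Algebra (ZMod 2) F]

theorem hasRecipSumZero_of_dvd {m : ℕ} (hm : 2 ≤ m)
    (hd : m ∣ Module.finrank (ZMod 2) F) : HasRecipSumZero F m := by
  have h2 : Module.finrank (ZMod 2) (GaloisField 2 m) = m := GaloisField.finrank 2 (by omega)
  obtain ⟨φ⟩ := FiniteField.nonempty_algHom_of_finrank_dvd (F := ZMod 2)
    (K := GaloisField 2 m) (L := F) (by rwa [h2])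
  have : Fintype (GaloisField 2 m) := Fintype.ofFinite _
  obtain ⟨L, a, σ, hL, hk⟩ := exists_recipSums (LinearMap.range φ.toLinearMap)
  have hcard : Nat.card (GaloisField 2 m) = 2 ^ m := GaloisField.card 2 m (by omega)
  have hnt : Nontrivial (GaloisField 2 m)ˣ := by
    rw [← Finite.one_lt_card_iff_nontrivial, Nat.card_units, hcard]
    have : 2 ^ 2 ≤ 2 ^ m := Nat.pow_le_pow_right (by norm_num) hm
    omega
  have hσ : σ = 0 := by
    rw [← hL.ker_sum]
    have : ({y | L y = 0} : Finset F) = univ.image φ := by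
      ext y
      have : L y = 0 ↔ y ∈ LinearMap.range φ.toLinearMap := by rw [← hk, LinearMap.mem_ker]
      simp [this]
    rw [this, sum_image fun x _ y _ (h : φ x = φ y) => φ.injective h]
    simp only [← map_inv₀, ← map_sum]
    rw [sum_inv_eq_zero, map_zero]
  subst hσ
  refine ⟨L, a, hL, ?_⟩
  rw [hk, LinearMap.finrank_range_of_inj φ.injective, h2]

theorem RecipSums.hasRecipSumZero_add_two {M : F →ₗ[ZMod 2] F} {b x y : F} (hM : RecipSums M b 1)
    (hx0 : x ≠ 0) (hy0 : y ≠ 0) (hxy : x ≠ y) (hN : x ^ 2 + x * y + y ^ 2 = 1)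
    (htx : ∀ f, M f = 0 → traceSign (f * x) = 1) (hty : ∀ f, M f = 0 → traceSign (f * y) = 1) :
    HasRecipSumZero F (Module.finrank (ZMod 2) (LinearMap.ker M) + 2) := by
  have two := two_eq_zero_of_algebra F
  obtain ⟨x, rfl⟩ := (sqrt_exists F).2 x
  obtain ⟨y, rfl⟩ := (sqrt_exists F).2 y
  obtain ⟨a, ha⟩ := (sqrt_exists F).2 (x * y * (x + y))⁻¹
  simp only at *
  have hx : x ≠ 0 := by rintro rfl; simp at hx0
  have hy : y ≠ 0 := by rintro rfl; simp at hy0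
  have hs : x + y ≠ 0 := by rw [Ne, add_eq_zero_iff_of_algebra]; rintro rfl; simp at hxy
  have hN' : x ^ 2 + x * y + y ^ 2 = 1 := by
    apply (sqrt_exists F).1
    simp only
    linear_combination hN + (x ^ 3 * y + x ^ 2 * y ^ 2 + x * y ^ 3) * two
  have ha0 : a ≠ 0 := by
    rintro rfl
    simp [hx, hy, hs] at ha
  have ha' : a ^ 2 * (x * y * (x + y)) = 1 := by
    rw [ha]
    exact inv_mul_cancel₀ (mul_ne_zero (mul_ne_zero hx hy) hs)
  have r1 := recipSums_artinSchreier (mul_ne_zero ha0 hx)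
  have e1 : artinSchreier (a * x) (a * y) = x⁻¹ := by
    rw [artinSchreier_apply]
    field_simp
    linear_combination ha'
  obtain ⟨r2, d2⟩ := r1.step (v := a * y) (by rw [e1]; exact inv_ne_zero hx)
  rw [e1] at r2 d2
  have hle : LinearMap.ker M ≤ LinearMap.range (artinSchreier x⁻¹ ∘ₗ artinSchreier (a * x)) := by
    intro f hf
    obtain ⟨m, hm⟩ := exists_sq_add_self_eq (htx f hf)
    have hw : (x⁻¹ * m) ^ 2 + x⁻¹ * (x⁻¹ * m) = f := by
      have : (x⁻¹ * m) ^ 2 + x⁻¹ * (x⁻¹ * m) = x⁻¹ ^ 2 * (m ^ 2 + m) := by ring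
      rw [this, hm]
      field_simp
    have h2 : traceSign (x⁻¹ * m / (a * x) ^ 2) = 1 := by
      have e : x⁻¹ * m / (a * x) ^ 2 = x⁻¹ * m * y + x⁻¹ * (x⁻¹ * m) * y ^ 2 := by
        field_simp
        linear_combination (-m) * ha'
      rw [e, traceSign_add, ← traceSign_sq (x⁻¹ * m * y), ← traceSign_add, ← hty f hf, ← hw]
      congr 1
      ring
    obtain ⟨m', hm'⟩ := exists_sq_add_self_eq h2
    refine ⟨a * x * m', ?_⟩
    have : artinSchreier (a * x) (a * x * m') = x⁻¹ * m := by
      rw [artinSchreier_apply]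
      have : (a * x * m') ^ 2 + a * x * (a * x * m') = (a * x) ^ 2 * (m' ^ 2 + m') := by ring
      rw [this, hm']
      field_simp
    rw [LinearMap.comp_apply, this, artinSchreier_apply, hw]
  have r3 := r2.comp hM hle
  have e3 : (a * x)⁻¹ + a * x * x⁻¹⁻¹ + a * x * x⁻¹ * 1 = 0 := by
    field_simp
    linear_combination a ^ 2 * x * hN' - ha' + a ^ 2 * x * two
  rw [e3] at r3
  refine ⟨_, _, r3, ?_⟩
  rw [finrank_ker_comp_of_le hle, d2, finrank_ker_artinSchreier (mul_ne_zero ha0 hx)]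
  omega

end

section
variable {F : Type*} [Field F] [Fintype F] [DecidableEq F] [Algebra (ZMod 2) F]

/-- The binary quadratic form `x² + xy + y²`. -/
def eisensteinNorm (x y : F) : F := x ^ 2 + x * y + y ^ 2

theorem eisensteinNorm_eq_zero_iff (h1 : traceSign (1 : F) = -1) {x y : F} :
    eisensteinNorm x y = 0 ↔ x = 0 ∧ y = 0 := by
  unfold eisensteinNorm
  refine ⟨fun h => ?_, by rintro ⟨rfl, rfl⟩; simp⟩
  by_cases hy : y = 0
  · subst hy
    simpa using h
  · exfalso
    have : (x / y) ^ 2 + x / y = 1 := by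
      field_simp
      linear_combination h - y ^ 2 * two_eq_zero_of_algebra F
    rw [← this, traceSign_add, traceSign_sq, traceSign_mul_self] at h1
    norm_num at h1

/-- The points of the conic `x² + xy + y² = 1`. -/
def eisensteinConic (F : Type*) [Field F] [Fintype F] [DecidableEq F] : Finset (F × F) :=
  {p | eisensteinNorm p.1 p.2 = 1}

theorem card_eisensteinNorm_eq_one (h1 : traceSign (1 : F) = -1) (x : F) :
    ((#{y : F | eisensteinNorm x y = 1} : ℕ) : ℤ) =
      1 - traceSign x⁻¹ + if x = 0 then 1 else 0 := by
  by_cases hx : x = 0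
  · subst hx
    have : ({y : F | eisensteinNorm 0 y = 1} : Finset F) = {1} := by
      ext y
      simp only [mem_filter, mem_univ, true_and, mem_singleton]
      unfold eisensteinNorm
      constructor
      · intro h
        apply (sqrt_exists F).1
        simp only
        linear_combination h
      · rintro rfl; ring
    rw [this]
    simp
  · have h2 : (1 : ℤ) - traceSign x⁻¹ = 1 + traceSign (1 + (x⁻¹) ^ 2) := by
      rw [traceSign_add, h1, traceSign_sq]
      ring
    rw [if_neg hx, h2, ← card_sq_add_self_eq, add_zero]
    norm_cast
    refine card_bij' (fun y _ => x⁻¹ * y) (fun y _ => x * y) ?_ ?_ ?_ ?_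
    · intro y hy
      simp only [mem_filter, mem_univ, true_and] at hy ⊢
      unfold eisensteinNorm at *
      field_simp
      linear_combination hy - x ^ 2 * two_eq_zero_of_algebra F
    · intro y hy
      simp only [mem_filter, mem_univ, true_and] at hy ⊢
      unfold eisensteinNorm at *
      field_simp at hy
      linear_combination hy + x ^ 2 * two_eq_zero_of_algebra F
    · intro y _; exact mul_inv_cancel_left₀ hx y
    · intro y _; exact inv_mul_cancel_left₀ hx y

theorem sum_eisensteinConic_fst (h1 : traceSign (1 : F) = -1) (a : F) :
    ∑ p ∈ eisensteinConic F, traceSign (a * p.1) =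
      1 - kloosterman a + if a = 0 then (Fintype.card F : ℤ) else 0 := by
  have e : ∀ x : F, ∑ y, (if eisensteinNorm x y = 1 then traceSign (a * x) else 0) =
      traceSign (a * x) - traceSign (a * x + x⁻¹) + if x = 0 then 1 else 0 := by
    intro x
    rw [← sum_filter, sum_const, nsmul_eq_mul, card_eisensteinNorm_eq_one h1, traceSign_add]
    split_ifs with h
    · simp [h]
    · ring
  rw [eisensteinConic, sum_filter, Fintype.sum_prod_type]
  simp only [e, sum_add_distrib, sum_sub_distrib, sum_traceSign_mul_eq, sum_ite_eq', mem_univ,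
    if_true]
  rw [kloosterman]
  ring

theorem sum_eisensteinConic (h1 : traceSign (1 : F) = -1) (f g : F) :
    ∑ p ∈ eisensteinConic F, traceSign (f * p.1 + g * p.2) =
      1 - kloosterman (eisensteinNorm f g) +
        if f = 0 ∧ g = 0 then (Fintype.card F : ℤ) else 0 := by
  have two := two_eq_zero_of_algebra F
  by_cases h : f = 0 ∧ g = 0
  · obtain ⟨rfl, rfl⟩ := h
    have := sum_eisensteinConic_fst h1 (0 : F)
    simpa [eisensteinNorm] using this
  · obtain ⟨r, hr⟩ := (sqrt_exists F).2 (eisensteinNorm f g)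
    simp only at hr
    have hr0 : r ≠ 0 := by
      rintro rfl
      exact h ((eisensteinNorm_eq_zero_iff h1).1 (by rw [← hr]; ring))
    have h2 := sum_eisensteinConic_fst h1 r
    rw [if_neg hr0] at h2
    rw [if_neg h, ← hr, kloosterman_sq, ← h2]
    unfold eisensteinNorm at hr
    refine sum_bij' (fun p _ => (r⁻¹ * (f * p.1 + g * p.2), r⁻¹ * (g * p.1 + (f + g) * p.2)))
      (fun p _ => (r⁻¹ * ((f + g) * p.1 + g * p.2), r⁻¹ * (g * p.1 + f * p.2))) ?_ ?_ ?_ ?_ ?_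
    · rintro ⟨x, y⟩ hp
      simp only [eisensteinConic, mem_filter, mem_univ, true_and] at hp ⊢
      unfold eisensteinNorm at *
      field_simp
      linear_combination r ^ 2 * hp - (x ^ 2 + x * y + y ^ 2) * hr + (2 * f * x * g * y +
        f * g * y ^ 2 + x * g ^ 2 * y + g ^ 2 * y ^ 2) * two
    · rintro ⟨x, y⟩ hp
      simp only [eisensteinConic, mem_filter, mem_univ, true_and] at hp ⊢
      unfold eisensteinNorm at *
      field_simp
      linear_combination r ^ 2 * hp - (x ^ 2 + x * y + y ^ 2) * hr + (2 * f * g * x * y +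
        f * g * x ^ 2 + g ^ 2 * x * y + g ^ 2 * x ^ 2) * two
    · rintro ⟨x, y⟩ _
      simp only [Prod.mk.injEq]
      constructor <;> field_simp
      · linear_combination (-x) * hr + (f * g * y + g ^ 2 * y) * two
      · linear_combination (-y) * hr + (f * g * x) * two
    · rintro ⟨x, y⟩ _
      simp only [Prod.mk.injEq]
      constructor <;> field_simp
      · linear_combination (-x) * hr + (f * g * y) * two
      · linear_combination (-y) * hr + (f * g * x + g ^ 2 * x) * two
    · rintro ⟨x, y⟩ _
      simp only
      congr 1
      field_simp

end

section
variable {F : Type*} [Field F] [Fintype F] [DecidableEq F] [Algebra (ZMod 2) F]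
  {V : Type*} [AddCommGroup V] [Module (ZMod 2) V] [Fintype V]

theorem traceSign_eq_one_or (x : F) : traceSign x = 1 ∨ traceSign x = -1 := by
  unfold traceSign; split_ifs <;> simp

theorem sum_traceSign_linearMap (φ : V →ₗ[ZMod 2] F) (x : F)
    [Decidable (∀ c, traceSign (φ c * x) = 1)] :
    ∑ c, traceSign (φ c * x) = if ∀ c, traceSign (φ c * x) = 1 then (Fintype.card V : ℤ) else 0 := by
  split_ifs with h
  · simp [h]
  · push Not at h
    obtain ⟨c, hc⟩ := h
    have hc := (traceSign_eq_one_or _).resolve_left hc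
    have h : ∑ d, traceSign (φ d * x) = ∑ d, traceSign (φ (d + c) * x) :=
      (Equiv.sum_comp (Equiv.addRight c) fun d => traceSign (φ d * x)).symm
    simp only [map_add, add_mul, traceSign_add, hc, ← sum_mul] at h
    omega

open Classical in
theorem card_orthogonal_eisensteinConic (h1 : traceSign (1 : F) = -1) (φ : V →ₗ[ZMod 2] F)
    (hφ : Function.Injective φ) :
    (Fintype.card V : ℤ) ^ 2 * #{p ∈ eisensteinConic F |
        (∀ c, traceSign (φ c * p.1) = 1) ∧ ∀ c, traceSign (φ c * p.2) = 1} =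
      (Fintype.card V : ℤ) ^ 2 + Fintype.card F -
        ∑ c : V × V, kloosterman (eisensteinNorm (φ c.1) (φ c.2)) := by
  have e1 : ∀ p ∈ eisensteinConic F, ∑ c : V × V, traceSign (φ c.1 * p.1 + φ c.2 * p.2) =
      if (∀ c, traceSign (φ c * p.1) = 1) ∧ ∀ c, traceSign (φ c * p.2) = 1 then
        (Fintype.card V : ℤ) ^ 2 else 0 := by
    intro p _
    simp only [traceSign_add, Fintype.sum_prod_type]
    rw [← sum_mul_sum, sum_traceSign_linearMap, sum_traceSign_linearMap]
    by_cases h : ∀ c, traceSign (φ c * p.1) = 1 <;>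
      by_cases h' : ∀ c, traceSign (φ c * p.2) = 1 <;> simp [h, h', sq]
  have e2 := sum_congr rfl e1
  rw [← sum_filter, sum_const, nsmul_eq_mul, mul_comm] at e2
  rw [← e2, sum_comm]
  simp only [sum_eisensteinConic h1, sum_add_distrib, sum_sub_distrib]
  have e3 : ∑ c : V × V, (if φ c.1 = 0 ∧ φ c.2 = 0 then (Fintype.card F : ℤ) else 0) =
      Fintype.card F := by
    rw [Fintype.sum_eq_single (0 : V × V)]
    · simp
    · rintro ⟨c, d⟩ h
      rw [if_neg]
      rintro ⟨hc, hd⟩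
      apply h
      rw [Prod.mk_eq_zero]
      exact ⟨hφ (by rw [hc, map_zero]), hφ (by rw [hd, map_zero])⟩
  rw [e3]
  simp
  ring

theorem sum_kloosterman_ge_of_not_hasRecipSumZero (h1 : traceSign (1 : F) = -1)
    (hcon : ¬ HasRecipSumZero F (Module.finrank (ZMod 2) V + 2)) (φ : V →ₗ[ZMod 2] F)
    (hφ : Function.Injective φ) (hσ : ∑ c, (φ c)⁻¹ = 1) :
    (Fintype.card F : ℤ) - 2 * (Fintype.card V : ℤ) ^ 2 ≤
      ∑ c : V × V, kloosterman (eisensteinNorm (φ c.1) (φ c.2)) := by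
  classical
  have hcard := card_orthogonal_eisensteinConic h1 φ hφ
  have h3 : #{p ∈ eisensteinConic F |
        (∀ c, traceSign (φ c * p.1) = 1) ∧ ∀ c, traceSign (φ c * p.2) = 1} ≤ 3 := by
    by_contra hlt
    have hlt : #({(0, 1), (1, 0), (1, 1)} : Finset (F × F)) < #{p ∈ eisensteinConic F |
        (∀ c, traceSign (φ c * p.1) = 1) ∧ ∀ c, traceSign (φ c * p.2) = 1} :=
      card_le_three.trans_lt (not_le.1 hlt)
    obtain ⟨⟨x, y⟩, hp, hne⟩ := exists_mem_notMem_of_card_lt_card hlt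
    simp only [eisensteinConic, mem_filter, mem_univ, true_and] at hp
    simp only [mem_insert, mem_singleton, Prod.mk.injEq, not_or] at hne
    obtain ⟨hN, hx, hy⟩ := hp
    unfold eisensteinNorm at hN
    have two := two_eq_zero_of_algebra F
    have hsq : ∀ z : F, z ^ 2 = 1 → z = 1 := fun z hz => (sqrt_exists F).1 (by simpa using hz)
    obtain ⟨M, b, σ, hM, hk⟩ := exists_recipSums (LinearMap.range φ)
    have hker : ∀ f, M f = 0 → ∃ c, φ c = f := by
      intro f hf
      have : f ∈ LinearMap.range φ := hk ▸ LinearMap.mem_ker.2 hf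
      exact this
    have hσ1 : σ = 1 := by
      rw [← hM.ker_sum, ← hσ]
      have : ({y | M y = 0} : Finset F) = univ.image φ := by
        ext y
        have : M y = 0 ↔ y ∈ LinearMap.range φ := by rw [← hk, LinearMap.mem_ker]
        simp [this]
      rw [this, sum_image fun x _ y _ (h : φ x = φ y) => hφ h]
    subst hσ1
    have := hM.hasRecipSumZero_add_two (x := x) (y := y) ?_ ?_ ?_ hN ?_ ?_
    · rw [hk, LinearMap.finrank_range_of_inj hφ] at this
      exact hcon this
    · rintro rfl
      exact hne.1 ⟨rfl, hsq y (by linear_combination hN)⟩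
    · rintro rfl
      exact hne.2.1 ⟨hsq x (by linear_combination hN), rfl⟩
    · rintro rfl
      have := hsq x (by linear_combination hN - x ^ 2 * two)
      exact hne.2.2 ⟨this, this⟩
    · intro f hf
      obtain ⟨c, rfl⟩ := hker f hf
      exact hx c
    · intro f hf
      obtain ⟨c, rfl⟩ := hker f hf
      exact hy c
  have h3' : ((#{p ∈ eisensteinConic F |
        (∀ c, traceSign (φ c * p.1) = 1) ∧ ∀ c, traceSign (φ c * p.2) = 1} : ℕ) : ℤ) ≤ 3 := by
    exact_mod_cast h3
  nlinarith [sq_nonneg (Fintype.card V : ℤ)]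

theorem hasRecipSumZero_of_family (h1 : traceSign (1 : F) = -1) (T : Finset F)
    (φ : F → V →ₗ[ZMod 2] F) (d : ℕ) (hφ : ∀ t ∈ T, Function.Injective (φ t))
    (hσ : ∀ t ∈ T, ∑ c, (φ t c)⁻¹ = 1)
    (hfib : ∀ c : V × V, c ≠ 0 → ∀ r,
      #{t ∈ T | eisensteinNorm (φ t c.1) (φ t c.2) = r} ≤ d)
    (hV : 2 * (Fintype.card V : ℤ) ^ 2 ≤ Fintype.card F)
    (hT : (Fintype.card V : ℤ) ^ 4 * d * (Fintype.card F : ℤ) ^ 2 <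
      #T * ((Fintype.card F : ℤ) - 2 * (Fintype.card V : ℤ) ^ 2) ^ 2) :
    HasRecipSumZero F (Module.finrank (ZMod 2) V + 2) := by
  by_contra hcon
  set Q : ℤ := (Fintype.card F : ℤ) with hQ
  set B : ℤ := Q - 2 * (Fintype.card V : ℤ) ^ 2 with hB
  set f : (V × V) × F → ℤ := fun p => kloosterman (eisensteinNorm (φ p.2 p.1.1) (φ p.2 p.1.2))
  have hlow : #T * B ≤ ∑ p ∈ univ ×ˢ T, f p := by
    rw [sum_product_right, ← nsmul_eq_mul]
    exact card_nsmul_le_sum _ _ _ fun t ht =>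
      sum_kloosterman_ge_of_not_hasRecipSumZero h1 hcon (φ t) (hφ t ht) (hσ t ht)
  have hup : ∑ p ∈ univ ×ˢ T, f p ^ 2 ≤ (Fintype.card V : ℤ) ^ 2 * (d * Q ^ 2) := by
    rw [sum_product]
    have : ((Fintype.card V : ℤ) ^ 2) = #(univ : Finset (V × V)) := by
      rw [card_univ, Fintype.card_prod, sq]; push_cast; rfl
    rw [this, ← nsmul_eq_mul]
    refine sum_le_card_nsmul _ _ _ fun c _ => ?_
    by_cases hc : c = 0
    · subst hc
      simp only [f, Prod.fst_zero, Prod.snd_zero, map_zero, eisensteinNorm]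
      simp only [mul_zero, add_zero, zero_pow two_ne_zero, kloosterman_zero, sum_const_zero]
      positivity
    · rw [hQ, ← sum_kloosterman_sq, mul_sum,
        ← sum_fiberwise T (fun t => eisensteinNorm (φ t c.1) (φ t c.2))]
      refine sum_le_sum fun r _ => ?_
      rw [sum_congr rfl (g := fun _ => kloosterman r ^ 2)
        fun t ht => by simp only [f]; rw [(mem_filter.1 ht).2], sum_const, nsmul_eq_mul]
      exact mul_le_mul_of_nonneg_right (by exact_mod_cast hfib c hc r) (sq_nonneg _)
  have hcs := sq_sum_le_card_mul_sum_sq (s := univ ×ˢ T) (f := f)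
  rw [card_product, card_univ, Fintype.card_prod] at hcs
  push_cast at hcs
  have hB0 : 0 ≤ B := by rw [hB]; linarith
  have hTpos : (0 : ℤ) < #T := by
    by_contra h0
    have : (#T : ℤ) = 0 := by omega
    rw [this, zero_mul] at hT
    have : 0 ≤ (Fintype.card V : ℤ) ^ 4 * d * Q ^ 2 := by positivity
    linarith
  have h4 : (#T * B) ^ 2 ≤ (∑ p ∈ univ ×ˢ T, f p) ^ 2 := pow_le_pow_left₀ (by positivity) hlow 2
  have h5 : (#T : ℤ) * (#T * B ^ 2) ≤ #T * ((Fintype.card V : ℤ) ^ 4 * d * Q ^ 2) := by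
    calc (#T : ℤ) * (#T * B ^ 2) = (#T * B) ^ 2 := by ring
      _ ≤ _ := h4.trans hcs
      _ ≤ (Fintype.card V * Fintype.card V * #T : ℤ) * ((Fintype.card V : ℤ) ^ 2 * (d * Q ^ 2)) :=
        mul_le_mul_of_nonneg_left hup (by positivity)
      _ = _ := by ring
  have := le_of_mul_le_mul_left h5 hTpos
  linarith

end

section
open Polynomial
variable {F : Type*} [Field F] [Fintype F] [DecidableEq F] [Algebra (ZMod 2) F]

theorem card_eval_eq_zero_le {R : F[X]} (hR : R ≠ 0) (T : Finset F) :
    #{t ∈ T | R.eval t = 0} ≤ R.natDegree := by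
  apply card_le_degree_of_subset_roots
  intro t ht
  have ht : t ∈ ({t ∈ T | R.eval t = 0} : Finset F) := ht
  rw [mem_roots hR]
  exact (mem_filter.1 ht).2

theorem card_eisensteinNorm_eval_le {M D P Q : F[X]} {T : Finset F} {S : F → F} {d : ℕ} (r : F)
    (hS : ∀ t ∈ T, S t * D.eval t = M.eval t) (hD : D.natDegree ≤ d)
    (hP : (M * P).natDegree ≤ d) (hQ : (M * Q).natDegree ≤ d)
    (hne : M ^ 2 * (P ^ 2 + P * Q + Q ^ 2) ≠ C r * D ^ 2) :
    #{t ∈ T | eisensteinNorm (S t * P.eval t) (S t * Q.eval t) = r} ≤ 2 * d := by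
  have hne' : M ^ 2 * (P ^ 2 + P * Q + Q ^ 2) - C r * D ^ 2 ≠ 0 := sub_ne_zero.2 hne
  refine (card_le_card ?_).trans ((card_eval_eq_zero_le hne' T).trans ?_)
  · intro t ht
    rw [mem_filter] at ht ⊢
    refine ⟨ht.1, ?_⟩
    have h := hS t ht.1
    simp only [eval_sub, eval_mul, eval_pow, eval_add, eval_C, ← h, ← ht.2, eisensteinNorm]
    ring
  · have e : M ^ 2 * (P ^ 2 + P * Q + Q ^ 2) - C r * D ^ 2 =
        (M * P) * (M * P) + (M * P) * (M * Q) + (M * Q) * (M * Q) - C r * (D * D) := by ring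
    rw [e, two_mul]
    refine (natDegree_sub_le _ _).trans (max_le (natDegree_add_le_of_degree_le
      (natDegree_add_le_of_degree_le ?_ ?_) ?_) ((natDegree_C_mul_le _ _).trans ?_))
    all_goals refine natDegree_mul_le_of_le ?_ ?_ <;> assumption

theorem sum_zmod_two {A : Type*} [AddCommMonoid A] (f : ZMod 2 → A) : ∑ r, f r = f 0 + f 1 :=
  Fin.sum_univ_two f

theorem ZMod.eq_zero_or_one_two : ∀ r : ZMod 2, r = 0 ∨ r = 1 := by decide

/-- The linear combinations of `1` and `t`, scaled by `s`. -/
noncomputable def pencil (s t : F) : ZMod 2 × ZMod 2 →ₗ[ZMod 2] F :=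
  (LinearMap.toSpanSingleton (ZMod 2) F s).coprod (LinearMap.toSpanSingleton (ZMod 2) F (s * t))

theorem pencil_apply (s t : F) (c : ZMod 2 × ZMod 2) :
    pencil s t c = s * (algebraMap _ F c.1 + algebraMap _ F c.2 * t) := by
  simp only [pencil, LinearMap.coprod_apply, LinearMap.toSpanSingleton_apply, Algebra.smul_def]
  ring

/-- The linear combinations of `1`, `t` and `t²`, scaled by `s`. -/
noncomputable def quadPencil (s t : F) : ZMod 2 × ZMod 2 × ZMod 2 →ₗ[ZMod 2] F :=
  (LinearMap.toSpanSingleton (ZMod 2) F s).coprod (pencil (s * t) t)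

theorem quadPencil_apply (s t : F) (c : ZMod 2 × ZMod 2 × ZMod 2) :
    quadPencil s t c =
      s * (algebraMap _ F c.1 + algebraMap _ F c.2.1 * t + algebraMap _ F c.2.2 * t ^ 2) := by
  simp only [quadPencil, LinearMap.coprod_apply, LinearMap.toSpanSingleton_apply, Algebra.smul_def,
    pencil_apply]
  ring

theorem hasRecipSumZero_four (h1 : traceSign (1 : F) = -1) (hq : 2048 ≤ Fintype.card F) :
    HasRecipSumZero F 4 := by
  have two := two_eq_zero_of_algebra F
  have hu1 : ∀ t : F, t ^ 2 + t + 1 ≠ 0 := by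
    intro t h
    have := (eisensteinNorm_eq_zero_iff h1 (x := t) (y := 1)).1
      (by unfold eisensteinNorm; linear_combination h)
    simp at this
  have hA : ∀ r : ZMod 2, algebraMap (ZMod 2) F r = 0 → r = 0 := fun r h =>
    (algebraMap (ZMod 2) F).injective (by rw [h, map_zero])
  set S : F → F := fun t => (t ^ 2 + t + 1) / (t ^ 2 + t)
  have hT : ∀ t ∈ (univ : Finset F) \ {0, 1}, t ≠ 0 ∧ t + 1 ≠ 0 ∧ t ^ 2 + t ≠ 0 ∧ S t ≠ 0 := by
    intro t ht
    simp only [mem_sdiff, mem_univ, mem_insert, mem_singleton, not_or, true_and] at ht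
    have h1 : t + 1 ≠ 0 := by rw [Ne, add_eq_zero_iff_of_algebra]; exact ht.2
    have h2 : t ^ 2 + t ≠ 0 := by
      rw [show t ^ 2 + t = t * (t + 1) by ring]
      exact mul_ne_zero ht.1 h1
    exact ⟨ht.1, h1, h2, div_ne_zero (hu1 t) h2⟩
  have hd : Module.finrank (ZMod 2) (ZMod 2 × ZMod 2) = 2 := by simp
  have hV : Fintype.card (ZMod 2 × ZMod 2) = 4 := by simp
  have key := hasRecipSumZero_of_family h1 (univ \ {0, 1}) (fun t => pencil (S t) t) 6 ?_ ?_ ?_ ?_ ?_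
  · rwa [hd] at key
  · intro t ht
    obtain ⟨h0, h2, -, hS⟩ := hT t ht
    rw [injective_iff_map_eq_zero]
    rintro ⟨a, b⟩ hab
    rw [pencil_apply] at hab
    have hab := (mul_eq_zero.1 hab).resolve_left hS
    rcases ZMod.eq_zero_or_one_two a with rfl | rfl <;>
      rcases ZMod.eq_zero_or_one_two b with rfl | rfl <;> simp_all [add_comm]
  · intro t ht
    obtain ⟨h0, h2, h3, hS⟩ := hT t ht
    have h4 := hu1 t
    have h5 : 1 + t ≠ 0 := by rwa [add_comm]
    have h6 : S t * (t ^ 2 + t) = t ^ 2 + t + 1 := div_mul_cancel₀ _ h3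
    simp only [pencil_apply, Fintype.sum_prod_type, sum_zmod_two, map_zero, map_one, zero_mul,
      one_mul, zero_add, add_zero, mul_zero, inv_zero, mul_one]
    field_simp
    linear_combination -h6 + t * two
  · rintro ⟨⟨a, b⟩, ⟨c, d⟩⟩ hne r
    simp only [pencil_apply]
    have := card_eisensteinNorm_eval_le (M := X ^ 2 + X + 1) (D := X ^ 2 + X)
      (P := C (algebraMap _ F a) + C (algebraMap _ F b) * X)
      (Q := C (algebraMap _ F c) + C (algebraMap _ F d) * X)
      (T := (univ : Finset F) \ {0, 1}) (S := S) (d := 3) r ?_ ?_ ?_ ?_ ?_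
    · simpa using this
    · intro t ht
      simpa using div_mul_cancel₀ _ (hT t ht).2.2.1
    · compute_degree!
    · compute_degree!
    · compute_degree!
    · intro h
      apply hne
      have e0 := congrArg (eval 0) h
      have e1 := congrArg (eval 1) h
      simp [add_self_eq_zero_of_algebra] at e0 e1
      obtain ⟨ha, hc⟩ := (eisensteinNorm_eq_zero_iff h1).1 e0
      obtain ⟨hb, hd⟩ := (eisensteinNorm_eq_zero_iff h1).1 e1
      rw [ha, zero_add] at hb
      rw [hc, zero_add] at hd
      rw [hA a ha, hA b hb, hA c hc, hA d hd]
      rfl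
  · rw [hV]
    push_cast
    linarith [(by exact_mod_cast hq : (2048 : ℤ) ≤ Fintype.card F)]
  · rw [hV, card_sdiff_of_subset (subset_univ _), card_pair zero_ne_one, card_univ,
      Nat.cast_sub Fintype.one_lt_card]
    have hq : (2048 : ℤ) ≤ Fintype.card F := by exact_mod_cast hq
    generalize (Fintype.card F : ℤ) = q at hq
    obtain ⟨r, rfl⟩ : ∃ r, q = 2048 + r := ⟨q - 2048, by ring⟩
    have hr : 0 ≤ r := by linarith
    push_cast
    have : 0 ≤ r ^ 2 := by positivity
    have : 0 ≤ r ^ 3 := by positivity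
    nlinarith

theorem hasRecipSumZero_five (h1 : traceSign (1 : F) = -1) (hq : 131072 ≤ Fintype.card F) :
    HasRecipSumZero F 5 := by
  have two := two_eq_zero_of_algebra F
  have hu1 : ∀ t : F, t ^ 2 + t + 1 ≠ 0 := by
    intro t h
    have := (eisensteinNorm_eq_zero_iff h1 (x := t) (y := 1)).1
      (by unfold eisensteinNorm; linear_combination h)
    simp at this
  have hA : ∀ r : ZMod 2, algebraMap (ZMod 2) F r = 0 → r = 0 := fun r h =>
    (algebraMap (ZMod 2) F).injective (by rw [h, map_zero])
  set M : F[X] := (X ^ 2 + X) ^ 3 + (X ^ 2 + X) + 1 with hM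
  set D : F[X] := (X ^ 2 + X) ^ 2 * (X ^ 2 + X + 1) with hD
  have hM0 : M ≠ 0 := fun h => by simpa [hM] using congrArg (eval 0) h
  have hMd : M.natDegree ≤ 6 := by rw [hM]; compute_degree
  set S : F → F := fun t => M.eval t / D.eval t
  set T : Finset F := univ \ ({0, 1} ∪ ({t | M.eval t = 0} : Finset F)) with hTdef
  have hT : ∀ t ∈ T, t ≠ 0 ∧ t + 1 ≠ 0 ∧ t ^ 2 + t ≠ 0 ∧ D.eval t ≠ 0 ∧ S t ≠ 0 := by
    intro t ht
    simp only [hTdef, mem_sdiff, mem_univ, mem_union, mem_filter, mem_insert, mem_singleton,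
      not_or, true_and] at ht
    have h1 : t + 1 ≠ 0 := by rw [Ne, add_eq_zero_iff_of_algebra]; exact ht.1.2
    have h2 : t ^ 2 + t ≠ 0 := by
      rw [show t ^ 2 + t = t * (t + 1) by ring]
      exact mul_ne_zero ht.1.1 h1
    have h3 : D.eval t ≠ 0 := by
      simp only [hD, eval_mul, eval_pow, eval_add, eval_X, eval_one]
      exact mul_ne_zero (pow_ne_zero _ h2) (hu1 t)
    exact ⟨ht.1.1, h1, h2, h3, div_ne_zero ht.2 h3⟩
  have hTcard : (Fintype.card F : ℤ) - 8 ≤ #T := by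
    have h2 := card_union_le ({0, 1} : Finset F) ({t | M.eval t = 0} : Finset F)
    have h3 := (card_eval_eq_zero_le hM0 univ).trans hMd
    have h4 : #({0, 1} : Finset F) = 2 := card_pair zero_ne_one
    have h5 := card_sdiff_add_card_eq_card
      (subset_univ ({0, 1} ∪ ({t | M.eval t = 0} : Finset F)))
    rw [card_univ] at h5
    change #T + _ = _ at h5
    omega
  have hd : Module.finrank (ZMod 2) (ZMod 2 × ZMod 2 × ZMod 2) = 3 := by simp
  have hV : Fintype.card (ZMod 2 × ZMod 2 × ZMod 2) = 8 := by simp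
  have key := hasRecipSumZero_of_family h1 T (fun t => quadPencil (S t) t) 16 ?_ ?_ ?_ ?_ ?_
  · rwa [hd] at key
  · intro t ht
    obtain ⟨h0, h2, h3, -, hS⟩ := hT t ht
    have h4 := hu1 t
    have h5 : 1 + t ^ 2 ≠ 0 := by
      rw [show 1 + t ^ 2 = (t + 1) ^ 2 by linear_combination (-t) * two]
      exact pow_ne_zero _ h2
    have h6 : 1 + t + t ^ 2 ≠ 0 := by
      rwa [show 1 + t + t ^ 2 = t ^ 2 + t + 1 by ring]
    rw [injective_iff_map_eq_zero]
    rintro ⟨a, b, c⟩ hab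
    rw [quadPencil_apply] at hab
    have hab := (mul_eq_zero.1 hab).resolve_left hS
    rcases ZMod.eq_zero_or_one_two a with rfl | rfl <;>
      rcases ZMod.eq_zero_or_one_two b with rfl | rfl <;>
      rcases ZMod.eq_zero_or_one_two c with rfl | rfl <;>
      simp only [map_zero, map_one, zero_mul, one_mul, zero_add, add_zero] at hab <;>
      first
      | rfl
      | exact absurd hab one_ne_zero
      | exact absurd hab h0
      | exact absurd hab (pow_ne_zero 2 h0)
      | exact absurd hab h5
      | exact absurd hab h6
      | exact absurd ((add_comm _ _).trans hab) h2
      | exact absurd ((add_comm _ _).trans hab) h3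
  · intro t ht
    obtain ⟨h0, h2, h3, h4, hS⟩ := hT t ht
    have h5 : t * (t + 1) + 1 ≠ 0 := by
      rw [show t * (t + 1) + 1 = t ^ 2 + t + 1 by ring]
      exact hu1 t
    have h6 : S t * D.eval t = M.eval t := div_mul_cancel₀ _ h4
    simp only [hD, hM, eval_mul, eval_pow, eval_add, eval_X, eval_one] at h6
    have e1 : t + t ^ 2 = t * (t + 1) := by ring
    have e2 : 1 + t ^ 2 = (t + 1) ^ 2 := by linear_combination (-t) * two
    simp only [quadPencil_apply, Fintype.sum_prod_type, sum_zmod_two, map_zero, map_one, zero_mul,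
      one_mul, zero_add, add_zero, mul_zero, inv_zero, mul_one]
    rw [e1, e2, show 1 + t + t ^ 2 = t * (t + 1) + 1 by ring, add_comm 1 t]
    generalize S t = s at hS h6 ⊢
    field_simp
    linear_combination (2 * t + 6 * t ^ 2 + 8 * t ^ 3 + 5 * t ^ 4 + t ^ 5) * two - h6
  · rintro ⟨⟨a, b, c⟩, ⟨a', b', c'⟩⟩ hne r
    simp only [quadPencil_apply]
    have := card_eisensteinNorm_eval_le (M := M) (D := D)
      (P := C (algebraMap _ F a) + C (algebraMap _ F b) * X + C (algebraMap _ F c) * X ^ 2)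
      (Q := C (algebraMap _ F a') + C (algebraMap _ F b') * X + C (algebraMap _ F c') * X ^ 2)
      (T := T) (S := S) (d := 8) r ?_ ?_ ?_ ?_ ?_
    · simpa using this
    · intro t ht
      exact div_mul_cancel₀ _ (hT t ht).2.2.2.1
    · rw [hD]; compute_degree!
    · rw [hM]; compute_degree!
    · rw [hM]; compute_degree!
    · intro h
      apply hne
      have e0 := congrArg (eval 0) h
      have e1 := congrArg (eval 1) h
      simp [hM, hD, add_self_eq_zero_of_algebra] at e0 e1
      obtain ⟨ha, ha'⟩ := (eisensteinNorm_eq_zero_iff h1).1 e0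
      obtain ⟨hb, hb'⟩ := (eisensteinNorm_eq_zero_iff h1).1 e1
      rw [ha, zero_add, add_eq_zero_iff_of_algebra] at hb
      rw [ha', zero_add, add_eq_zero_iff_of_algebra] at hb'
      have h2 : (X ^ 2 + X : F[X]) ^ 2 ≠ 0 := by
        apply pow_ne_zero
        intro h
        simpa [coeff_X] using congrArg (fun p => coeff p 2) h
      have h3 : M ^ 2 * C (eisensteinNorm (algebraMap _ F c) (algebraMap _ F c')) =
          C r * ((X ^ 2 + X) ^ 2 * (X ^ 2 + X + 1) ^ 2) := by
        apply mul_left_cancel₀ h2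
        rw [ha, ha', hb, hb', hD] at h
        simp only [eisensteinNorm, C_add, C_mul, C_pow, C_0] at h ⊢
        linear_combination h
      have h4 := congrArg (eval 0) h3
      simp [hM] at h4
      obtain ⟨hc, hc'⟩ := (eisensteinNorm_eq_zero_iff h1).1 h4
      rw [hc] at hb
      rw [hc'] at hb'
      rw [hA a ha, hA b hb, hA c hc, hA a' ha', hA b' hb', hA c' hc']
      rfl
  · rw [hV]
    push_cast
    linarith [(by exact_mod_cast hq : (131072 : ℤ) ≤ Fintype.card F)]
  · rw [hV]
    have hq : (131072 : ℤ) ≤ Fintype.card F := by exact_mod_cast hq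
    refine lt_of_lt_of_le ?_ (mul_le_mul_of_nonneg_right hTcard (sq_nonneg _))
    generalize (Fintype.card F : ℤ) = q at hq
    obtain ⟨r, rfl⟩ : ∃ r, q = 131072 + r := ⟨q - 131072, by ring⟩
    have hr : 0 ≤ r := by linarith
    push_cast
    have : 0 ≤ r ^ 2 := by positivity
    have : 0 ≤ r ^ 3 := by positivity
    nlinarith

end

section
open Polynomial
variable {F : Type*} [Field F] [Fintype F] [DecidableEq F] [Algebra (ZMod 2) F]

theorem exists_algebraMap_eq_of_pow_card {K : Type*} [Field K] [Algebra F K] {x : K}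
    (h : x ^ Fintype.card F = x) : ∃ a : F, algebraMap F K a = x := by
  have h0 : (X ^ Fintype.card F - X : F[X]) ≠ 0 :=
    FiniteField.X_pow_card_sub_X_ne_zero F Fintype.one_lt_card
  have hs : (X ^ Fintype.card F - X : F[X]).Splits := by
    rw [splits_iff_card_roots, FiniteField.roots_X_pow_card_sub_X,
      FiniteField.X_pow_card_sub_X_natDegree_eq F Fintype.one_lt_card]
    rfl
  have hr := hs.mem_range_of_isRoot h0 (i := algebraMap F K) (x := x)
    (by simp [IsRoot.def, h])
  exact hr

/-- A polynomial over `F` of nonzero degree whose roots are all fixed by the Frobenius of `F`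
has a root in `F`. -/
theorem exists_aeval_eq_zero_of_pow_card {p : F[X]} (hp : p.degree ≠ 0)
    (h : ∀ x : AlgebraicClosure F, aeval x p = 0 → x ^ Fintype.card F = x) :
    ∃ a : F, aeval a p = 0 := by
  obtain ⟨x, hx⟩ := IsAlgClosed.exists_aeval_eq_zero (AlgebraicClosure F) p hp
  obtain ⟨a, rfl⟩ := exists_algebraMap_eq_of_pow_card (h x hx)
  refine ⟨a, (algebraMap F (AlgebraicClosure F)).injective ?_⟩
  rw [map_zero, ← hx, aeval_algebraMap_apply]

theorem RecipSums.step_of_eq {L : F →ₗ[ZMod 2] F} {a σ v δ ι a' σ' : F} (hL : RecipSums L a σ)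
    (hv : L v = δ) (hδ : δ * ι = 1) (ha : a * δ = a') (hσ : σ + a * ι = σ') :
    RecipSums (artinSchreier δ ∘ₗ L) a' σ' ∧
      Module.finrank (ZMod 2) (LinearMap.ker (artinSchreier δ ∘ₗ L)) =
        Module.finrank (ZMod 2) (LinearMap.ker L) + 1 := by
  have h := hL.step (v := v) (hv ▸ left_ne_zero_of_mul_eq_one hδ)
  rw [hv] at h
  rwa [ha, ← eq_inv_of_mul_eq_one_right hδ, hσ] at h

theorem pow_two_pow_nine_eq {K : Type*} [Field K] (two : (2 : K) = 0) {γ : K}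
    (hγ : γ ^ 9 = γ ^ 8 + γ ^ 7 + γ ^ 3 + γ ^ 2 + γ + 1) : γ ^ 2 ^ 9 = γ := by
  have h4 : γ ^ 2 ^ 4 = γ ^ 7 + γ ^ 6 + γ ^ 3 := by
    rw [pow_succ, pow_mul]
    linear_combination (γ ^ 7 + γ ^ 6 + 2 * γ ^ 5 + 3 * γ ^ 4 + 5 * γ ^ 3 + 8 * γ ^ 2 + 14 * γ +
      24) * hγ + (21 * γ ^ 8 + 15 * γ ^ 7 + 5 * γ ^ 6 + 9 * γ ^ 5 + 15 * γ ^ 4 + 25 * γ ^ 3 +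
      23 * γ ^ 2 + 19 * γ + 12) * two
  have h5 : γ ^ 2 ^ 5 = γ ^ 8 + γ ^ 7 + γ ^ 5 + γ ^ 4 + γ ^ 3 + 1 := by
    rw [pow_succ, pow_mul, h4]
    linear_combination (γ ^ 5 + 3 * γ ^ 4 + 5 * γ ^ 3 + 8 * γ ^ 2 + 15 * γ + 25) * hγ +
      (20 * γ ^ 8 + 14 * γ ^ 7 + 5 * γ ^ 6 + 8 * γ ^ 5 + 15 * γ ^ 4 + 26 * γ ^ 3 + 24 * γ ^ 2 +
      20 * γ + 12) * two
  have h6 : γ ^ 2 ^ 6 = γ ^ 8 + γ ^ 5 + γ ^ 3 + γ := by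
    rw [pow_succ, pow_mul, h5]
    linear_combination (γ ^ 7 + 3 * γ ^ 6 + 5 * γ ^ 5 + 10 * γ ^ 4 + 19 * γ ^ 3 + 33 * γ ^ 2 +
      56 * γ + 95) * hγ + (82 * γ ^ 8 + 59 * γ ^ 7 + 19 * γ ^ 6 + 34 * γ ^ 5 + 60 * γ ^ 4 +
      102 * γ ^ 3 + 92 * γ ^ 2 + 75 * γ + 48) * two
  have h7 : γ ^ 2 ^ 7 = γ ^ 4 + γ ^ 3 + γ ^ 2 + 1 := by
    rw [pow_succ, pow_mul, h6]
    linear_combination (γ ^ 7 + γ ^ 6 + 2 * γ ^ 5 + 5 * γ ^ 4 + 7 * γ ^ 3 + 14 * γ ^ 2 + 23 * γ +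
      41) * hγ + (35 * γ ^ 8 + 25 * γ ^ 7 + 9 * γ ^ 6 + 14 * γ ^ 5 + 25 * γ ^ 4 + 42 * γ ^ 3 +
      39 * γ ^ 2 + 32 * γ + 20) * two
  have h8 : γ ^ 2 ^ 8 = γ ^ 8 + γ ^ 6 + γ ^ 4 + 1 := by
    rw [pow_succ, pow_mul, h7]
    linear_combination (γ ^ 7 + γ ^ 6 + γ ^ 5 + γ ^ 4 + γ ^ 3 + γ ^ 2) * two
  have h9 : γ ^ 2 ^ 9 = γ := by
    rw [pow_succ, pow_mul, h8]
    linear_combination (γ ^ 7 + γ ^ 6 + 4 * γ ^ 5 + 5 * γ ^ 4 + 12 * γ ^ 3 + 17 * γ ^ 2 + 32 * γ +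
      51) * hγ + (46 * γ ^ 8 + 31 * γ ^ 7 + 12 * γ ^ 6 + 19 * γ ^ 5 + 34 * γ ^ 4 + 56 * γ ^ 3 +
      50 * γ ^ 2 + 41 * γ + 26) * two
  exact h9

theorem hasRecipSumZero_four_of_pow_nine {γ : F}
    (hγ : γ ^ 9 = γ ^ 8 + γ ^ 7 + γ ^ 3 + γ ^ 2 + γ + 1) : HasRecipSumZero F 4 := by
  have two := two_eq_zero_of_algebra F
  have r1 : RecipSums (artinSchreier (1 : F)) 1 1 := by
    simpa using recipSums_artinSchreier (one_ne_zero (α := F))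
  have d1 := finrank_ker_artinSchreier (one_ne_zero (α := F))
  set L1 := artinSchreier (1 : F)
  have v1_1 : L1 γ = γ ^ 2 + γ := by
    rw [artinSchreier_apply]
    ring
  have v1_3 : L1 (γ ^ 3) = γ ^ 6 + γ ^ 3 := by
    rw [artinSchreier_apply]
    ring
  have v1_5 : L1 (γ ^ 5) = γ ^ 7 + γ ^ 5 + γ ^ 4 + 1 := by
    rw [artinSchreier_apply]
    linear_combination (γ + 1) * hγ + (γ ^ 8 + γ ^ 3 + γ ^ 2 + γ) * two
  obtain ⟨r2, d2⟩ := r1.step_of_eq v1_1 (ι := γ ^ 7 + γ ^ 5 + γ ^ 4 + γ ^ 3 + γ ^ 2 + 1)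
    (a' := γ ^ 2 + γ)
    (σ' := γ ^ 7 + γ ^ 5 + γ ^ 4 + γ ^ 3 + γ ^ 2)
    (by linear_combination (1) * hγ + (γ ^ 8 + γ ^ 7 + γ ^ 6 + γ ^ 5 + γ ^ 4 + γ ^ 3 + γ ^ 2 +
      γ) * two)
    (by ring)
    (by linear_combination (1) * two)
  set L2 := artinSchreier (γ ^ 2 + γ) ∘ₗ L1
  have v2_3 : L2 (γ ^ 3) = γ ^ 5 + γ ^ 4 + γ ^ 3 + γ + 1 := by
    rw [LinearMap.comp_apply, v1_3, artinSchreier_apply]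
    linear_combination (γ ^ 3 + γ ^ 2 + 2 * γ + 5) * hγ + (4 * γ ^ 8 + 3 * γ ^ 7 + γ ^ 6 + γ ^ 5 +
      2 * γ ^ 4 + 4 * γ ^ 3 + 4 * γ ^ 2 + 3 * γ + 2) * two
  have v2_5 : L2 (γ ^ 5) = γ ^ 8 + γ ^ 7 + γ ^ 3 + γ + 1 := by
    rw [LinearMap.comp_apply, v1_5, artinSchreier_apply]
    linear_combination (γ ^ 5 + γ ^ 4 + 4 * γ ^ 3 + 7 * γ ^ 2 + 12 * γ + 22) * hγ + (18 * γ ^ 8 +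
      13 * γ ^ 7 + 4 * γ ^ 6 + 8 * γ ^ 5 + 13 * γ ^ 4 + 22 * γ ^ 3 + 21 * γ ^ 2 + 17 * γ + 11) * two
  obtain ⟨r3, d3⟩ := r2.step_of_eq v2_3 (ι := γ ^ 8 + γ ^ 5)
    (a' := γ ^ 7 + γ ^ 4 + γ ^ 3 + γ)
    (σ' := γ ^ 8 + γ ^ 6 + γ ^ 5 + γ)
    (by linear_combination (γ ^ 4 + 2 * γ ^ 3 + 4 * γ ^ 2 + 7 * γ + 13) * hγ + (11 * γ ^ 8 +
      7 * γ ^ 7 + 2 * γ ^ 6 + 4 * γ ^ 5 + 7 * γ ^ 4 + 13 * γ ^ 3 + 12 * γ ^ 2 + 10 * γ + 6) * two)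
    (by linear_combination (γ ^ 6 + γ ^ 5 + γ ^ 2) * two)
    (by linear_combination (γ + 2) * hγ + (γ ^ 8 + 2 * γ ^ 7 + γ ^ 4 + 2 * γ ^ 3 + 2 * γ ^ 2 + γ +
      1) * two)
  set L3 := artinSchreier (γ ^ 5 + γ ^ 4 + γ ^ 3 + γ + 1) ∘ₗ L2
  have v3_5 : L3 (γ ^ 5) = γ ^ 7 + γ ^ 5 + γ ^ 3 + γ ^ 2 + 1 := by
    rw [LinearMap.comp_apply, v2_5, artinSchreier_apply]
    linear_combination (γ ^ 7 + 3 * γ ^ 6 + 5 * γ ^ 5 + 9 * γ ^ 4 + 16 * γ ^ 3 + 29 * γ ^ 2 +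
      49 * γ + 85) * hγ + (75 * γ ^ 8 + 53 * γ ^ 7 + 18 * γ ^ 6 + 30 * γ ^ 5 + 54 * γ ^ 4 +
      91 * γ ^ 3 + 82 * γ ^ 2 + 69 * γ + 43) * two
  obtain ⟨r4, d4⟩ := r3.step_of_eq v3_5 (ι := γ ^ 8 + γ ^ 6 + γ ^ 2)
    (a' := γ ^ 7 + γ ^ 5 + γ ^ 4 + γ ^ 3 + 1)
    (σ' := 0)
    (by linear_combination (γ ^ 6 + γ ^ 5 + 4 * γ ^ 4 + 5 * γ ^ 3 + 11 * γ ^ 2 + 17 * γ +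
      31) * hγ + (26 * γ ^ 8 + 19 * γ ^ 7 + 6 * γ ^ 6 + 11 * γ ^ 5 + 19 * γ ^ 4 + 32 * γ ^ 3 +
      30 * γ ^ 2 + 24 * γ + 15) * two)
    (by linear_combination (γ ^ 5 + γ ^ 4 + 3 * γ ^ 3 + 5 * γ ^ 2 + 10 * γ + 17) * hγ +
      (15 * γ ^ 8 + 10 * γ ^ 7 + 4 * γ ^ 6 + 5 * γ ^ 5 + 10 * γ ^ 4 + 18 * γ ^ 3 + 16 * γ ^ 2 +
      14 * γ + 8) * two)
    (by linear_combination (γ ^ 6 + γ ^ 5 + 3 * γ ^ 4 + 5 * γ ^ 3 + 9 * γ ^ 2 + 15 * γ +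
      28) * hγ + (23 * γ ^ 8 + 17 * γ ^ 7 + 6 * γ ^ 6 + 10 * γ ^ 5 + 16 * γ ^ 4 + 29 * γ ^ 3 +
      26 * γ ^ 2 + 22 * γ + 14) * two)
  exact ⟨_, _, r4, by rw [d4, d3, d2, d1]⟩

theorem pow_two_pow_thirteen_eq {K : Type*} [Field K] (two : (2 : K) = 0) {γ : K}
    (hγ : γ ^ 13 = γ ^ 9 + γ ^ 8 + γ ^ 6 + γ ^ 4 + γ ^ 2 + 1) : γ ^ 2 ^ 13 = γ := by
  have h4 : γ ^ 2 ^ 4 = γ ^ 12 + γ ^ 11 + γ ^ 9 + γ ^ 7 + γ ^ 5 + γ ^ 3 := by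
    rw [pow_succ, pow_mul]
    linear_combination (γ ^ 3) * hγ
  have h5 : γ ^ 2 ^ 5 = γ ^ 6 + γ ^ 5 + γ ^ 4 + γ ^ 3 + γ ^ 2 + 1 := by
    rw [pow_succ, pow_mul, h4]
    linear_combination (γ ^ 11 + 2 * γ ^ 10 + γ ^ 9 + 2 * γ ^ 8 + 3 * γ ^ 7 + 5 * γ ^ 6 +
      6 * γ ^ 5 + 6 * γ ^ 4 + 11 * γ ^ 3 + 12 * γ ^ 2 + 20 * γ + 17) * hγ + (15 * γ ^ 12 +
      17 * γ ^ 11 + 25 * γ ^ 10 + 29 * γ ^ 9 + 22 * γ ^ 8 + 20 * γ ^ 7 + 20 * γ ^ 6 + 18 * γ ^ 5 +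
      17 * γ ^ 4 + 15 * γ ^ 3 + 14 * γ ^ 2 + 10 * γ + 8) * two
  have h6 : γ ^ 2 ^ 6 = γ ^ 12 + γ ^ 10 + γ ^ 8 + γ ^ 6 + γ ^ 4 + 1 := by
    rw [pow_succ, pow_mul, h5]
    linear_combination (γ ^ 11 + γ ^ 10 + 2 * γ ^ 9 + 2 * γ ^ 8 + 2 * γ ^ 7 + 2 * γ ^ 6 +
      2 * γ ^ 5 + γ ^ 4 + γ ^ 3 + γ ^ 2) * two
  have h7 : γ ^ 2 ^ 7 = γ ^ 10 + γ ^ 8 + γ ^ 4 + γ + 1 := by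
    rw [pow_succ, pow_mul, h6]
    linear_combination (γ ^ 11 + 2 * γ ^ 9 + 4 * γ ^ 7 + γ ^ 6 + 6 * γ ^ 5 + 3 * γ ^ 4 +
      9 * γ ^ 3 + 8 * γ ^ 2 + 11 * γ + 16) * hγ + (9 * γ ^ 12 + 15 * γ ^ 11 + 13 * γ ^ 10 +
      24 * γ ^ 9 + 15 * γ ^ 8 + 15 * γ ^ 7 + 15 * γ ^ 6 + 13 * γ ^ 5 + 14 * γ ^ 4 + 10 * γ ^ 3 +
      12 * γ ^ 2 + 5 * γ + 8) * two
  have h8 : γ ^ 2 ^ 8 = γ ^ 10 + γ ^ 8 + γ ^ 7 + γ ^ 2 := by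
    rw [pow_succ, pow_mul, h7]
    linear_combination (γ ^ 7 + 2 * γ ^ 5 + 2 * γ ^ 3 + γ ^ 2 + 4 * γ + 3) * hγ + (2 * γ ^ 12 +
      4 * γ ^ 11 + 3 * γ ^ 10 + 7 * γ ^ 9 + 3 * γ ^ 8 + 4 * γ ^ 7 + 2 * γ ^ 6 + 5 * γ ^ 5 +
      3 * γ ^ 4 + 3 * γ ^ 3 + 2 * γ ^ 2 + 3 * γ + 2) * two
  have h9 : γ ^ 2 ^ 9 = γ ^ 9 + γ ^ 5 + γ ^ 4 + γ ^ 3 + γ + 1 := by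
    rw [pow_succ, pow_mul, h8]
    linear_combination (γ ^ 7 + 2 * γ ^ 5 + 2 * γ ^ 4 + 2 * γ ^ 3 + 3 * γ ^ 2 + 3 * γ + 5) * hγ +
      (3 * γ ^ 12 + 4 * γ ^ 11 + 5 * γ ^ 10 + 7 * γ ^ 9 + 5 * γ ^ 8 + 4 * γ ^ 7 + 5 * γ ^ 6 +
      3 * γ ^ 5 + 5 * γ ^ 4 + 2 * γ ^ 3 + 4 * γ ^ 2 + γ + 2) * two
  have h10 : γ ^ 2 ^ 10 = γ ^ 11 + γ ^ 9 + γ ^ 4 + γ ^ 3 + γ := by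
    rw [pow_succ, pow_mul, h9]
    linear_combination (γ ^ 5 + 3 * γ + 3) * hγ + (γ ^ 12 + 3 * γ ^ 10 + 5 * γ ^ 9 + 3 * γ ^ 8 +
      3 * γ ^ 7 + 3 * γ ^ 6 + 4 * γ ^ 5 + 3 * γ ^ 4 + 2 * γ ^ 3 + 2 * γ ^ 2 + 2 * γ + 2) * two
  have h11 : γ ^ 2 ^ 11 = γ ^ 12 + γ ^ 9 + γ ^ 8 + γ ^ 6 := by
    rw [pow_succ, pow_mul, h10]
    linear_combination (γ ^ 9 + 2 * γ ^ 7 + 2 * γ ^ 5 + γ ^ 4 + 2 * γ ^ 3 + 5 * γ ^ 2 + 4 * γ +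
      8) * hγ + (3 * γ ^ 12 + 6 * γ ^ 11 + 6 * γ ^ 10 + 9 * γ ^ 9 + 7 * γ ^ 8 + 6 * γ ^ 7 +
      7 * γ ^ 6 + 5 * γ ^ 5 + 8 * γ ^ 4 + 3 * γ ^ 3 + 7 * γ ^ 2 + 2 * γ + 4) * two
  have h12 : γ ^ 2 ^ 12 = γ ^ 12 + γ ^ 10 + γ ^ 8 + γ ^ 6 + γ ^ 5 + γ ^ 2 := by
    rw [pow_succ, pow_mul, h11]
    linear_combination (γ ^ 11 + 2 * γ ^ 8 + 3 * γ ^ 7 + γ ^ 6 + 3 * γ ^ 5 + 5 * γ ^ 4 +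
      6 * γ ^ 3 + 7 * γ ^ 2 + 8 * γ + 12) * hγ + (7 * γ ^ 12 + 10 * γ ^ 11 + 11 * γ ^ 10 +
      16 * γ ^ 9 + 13 * γ ^ 8 + 10 * γ ^ 7 + 12 * γ ^ 6 + 8 * γ ^ 5 + 12 * γ ^ 4 + 7 * γ ^ 3 +
      9 * γ ^ 2 + 4 * γ + 6) * two
  have h13 : γ ^ 2 ^ 13 = γ := by
    rw [pow_succ, pow_mul, h12]
    linear_combination (γ ^ 11 + 2 * γ ^ 9 + 4 * γ ^ 7 + γ ^ 6 + 6 * γ ^ 5 + 5 * γ ^ 4 +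
      7 * γ ^ 3 + 10 * γ ^ 2 + 11 * γ + 20) * hγ + (8 * γ ^ 12 + 16 * γ ^ 11 + 15 * γ ^ 10 +
      25 * γ ^ 9 + 19 * γ ^ 8 + 15 * γ ^ 7 + 18 * γ ^ 6 + 12 * γ ^ 5 + 18 * γ ^ 4 + 9 * γ ^ 3 +
      15 * γ ^ 2 + 5 * γ + 10) * two
  exact h13

theorem hasRecipSumZero_five_of_pow_thirteen {γ : F}
    (hγ : γ ^ 13 = γ ^ 9 + γ ^ 8 + γ ^ 6 + γ ^ 4 + γ ^ 2 + 1) : HasRecipSumZero F 5 := by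
  have two := two_eq_zero_of_algebra F
  have r1 : RecipSums (artinSchreier (1 : F)) 1 1 := by
    simpa using recipSums_artinSchreier (one_ne_zero (α := F))
  have d1 := finrank_ker_artinSchreier (one_ne_zero (α := F))
  set L1 := artinSchreier (1 : F)
  have v1_1 : L1 γ = γ ^ 2 + γ := by
    rw [artinSchreier_apply]
    ring
  have v1_2 : L1 (γ ^ 2) = γ ^ 4 + γ ^ 2 := by
    rw [artinSchreier_apply]
    ring
  have v1_5 : L1 (γ ^ 5) = γ ^ 10 + γ ^ 5 := by
    rw [artinSchreier_apply]
    ring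
  have v1_8 : L1 (γ ^ 8) = γ ^ 12 + γ ^ 11 + γ ^ 9 + γ ^ 8 + γ ^ 7 + γ ^ 5 + γ ^ 3 := by
    rw [artinSchreier_apply]
    linear_combination (γ ^ 3) * hγ
  obtain ⟨r2, d2⟩ := r1.step_of_eq v1_1 (ι := γ ^ 11 + γ ^ 10 + γ ^ 9 + γ ^ 8 + γ ^ 6 + γ ^ 5 + γ ^ 2 + γ)
    (a' := γ ^ 2 + γ)
    (σ' := γ ^ 11 + γ ^ 10 + γ ^ 9 + γ ^ 8 + γ ^ 6 + γ ^ 5 + γ ^ 2 + γ + 1)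
    (by linear_combination (1) * hγ + (γ ^ 12 + γ ^ 11 + γ ^ 10 + γ ^ 9 + γ ^ 8 + γ ^ 7 + γ ^ 6 +
      γ ^ 4 + γ ^ 3 + γ ^ 2) * two)
    (by ring)
    (by ring)
  set L2 := artinSchreier (γ ^ 2 + γ) ∘ₗ L1
  have v2_2 : L2 (γ ^ 2) = γ ^ 8 + γ ^ 6 + γ ^ 5 + γ ^ 3 := by
    rw [LinearMap.comp_apply, v1_2, artinSchreier_apply]
    linear_combination (γ ^ 6 + γ ^ 4) * two
  have v2_5 : L2 (γ ^ 5) = γ ^ 9 + γ ^ 7 + γ ^ 6 + γ ^ 5 + γ ^ 3 + 1 := by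
    rw [LinearMap.comp_apply, v1_5, artinSchreier_apply]
    linear_combination (γ ^ 7 + γ ^ 3 + 3 * γ ^ 2 + 1) * hγ + (γ ^ 12 + 3 * γ ^ 11 + 2 * γ ^ 10 +
      γ ^ 9 + 2 * γ ^ 8 + γ ^ 7 + 2 * γ ^ 6 + 2 * γ ^ 4 + 2 * γ ^ 2) * two
  have v2_8 : L2 (γ ^ 8) = γ ^ 10 + γ ^ 8 + γ ^ 7 + γ ^ 3 + γ ^ 2 + γ + 1 := by
    rw [LinearMap.comp_apply, v1_8, artinSchreier_apply]
    linear_combination (γ ^ 11 + 2 * γ ^ 10 + γ ^ 9 + 2 * γ ^ 8 + 5 * γ ^ 7 + 7 * γ ^ 6 +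
      6 * γ ^ 5 + 8 * γ ^ 4 + 14 * γ ^ 3 + 18 * γ ^ 2 + 23 * γ + 25) * hγ + (19 * γ ^ 12 +
      24 * γ ^ 11 + 32 * γ ^ 10 + 38 * γ ^ 9 + 31 * γ ^ 8 + 24 * γ ^ 7 + 30 * γ ^ 6 + 22 * γ ^ 5 +
      26 * γ ^ 4 + 18 * γ ^ 3 + 21 * γ ^ 2 + 11 * γ + 12) * two
  obtain ⟨r3, d3⟩ := r2.step_of_eq v2_2 (ι := γ ^ 12 + γ ^ 8 + γ ^ 7 + γ ^ 2 + γ)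
    (a' := γ ^ 10 + γ ^ 9 + γ ^ 8 + γ ^ 6 + γ ^ 5 + γ ^ 4)
    (σ' := γ ^ 11 + γ ^ 10 + γ ^ 9 + γ ^ 8 + γ ^ 7 + γ ^ 3 + γ ^ 2)
    (by linear_combination (γ ^ 7 + γ ^ 5 + γ ^ 4 + 2 * γ ^ 3 + 3 * γ ^ 2 + 2 * γ + 5) * hγ +
      (2 * γ ^ 12 + 4 * γ ^ 11 + 4 * γ ^ 10 + 6 * γ ^ 9 + 5 * γ ^ 8 + 4 * γ ^ 7 + 5 * γ ^ 6 +
      3 * γ ^ 5 + 5 * γ ^ 4 + 2 * γ ^ 3 + 4 * γ ^ 2 + γ + 2) * two)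
    (by linear_combination (γ ^ 7) * two)
    (by linear_combination (γ + 1) * hγ + (γ ^ 10 + 2 * γ ^ 9 + γ ^ 8 + γ ^ 6 + γ ^ 5 + γ ^ 4 +
      γ ^ 3 + γ ^ 2 + γ + 1) * two)
  set L3 := artinSchreier (γ ^ 8 + γ ^ 6 + γ ^ 5 + γ ^ 3) ∘ₗ L2
  have v3_5 : L3 (γ ^ 5) = γ ^ 12 + γ ^ 9 + γ ^ 7 + γ ^ 4 + γ ^ 3 + 1 := by
    rw [LinearMap.comp_apply, v2_5, artinSchreier_apply]
    linear_combination (γ ^ 5 + γ ^ 4 + 2 * γ ^ 3 + 4 * γ ^ 2 + 6 * γ + 6) * hγ + (5 * γ ^ 12 +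
      6 * γ ^ 11 + 8 * γ ^ 10 + 10 * γ ^ 9 + 8 * γ ^ 8 + 5 * γ ^ 7 + 8 * γ ^ 6 + 6 * γ ^ 5 +
      5 * γ ^ 4 + 5 * γ ^ 3 + 5 * γ ^ 2 + 3 * γ + 3) * two
  have v3_8 : L3 (γ ^ 8) = γ ^ 12 + γ ^ 11 + γ ^ 8 + γ ^ 7 + γ ^ 2 + γ := by
    rw [LinearMap.comp_apply, v2_8, artinSchreier_apply]
    linear_combination (γ ^ 7 + 3 * γ ^ 5 + 2 * γ ^ 4 + 4 * γ ^ 3 + 5 * γ ^ 2 + 5 * γ + 11) * hγ +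
      (4 * γ ^ 12 + 9 * γ ^ 11 + 10 * γ ^ 10 + 15 * γ ^ 9 + 12 * γ ^ 8 + 8 * γ ^ 7 + 11 * γ ^ 6 +
      8 * γ ^ 5 + 11 * γ ^ 4 + 7 * γ ^ 3 + 9 * γ ^ 2 + 3 * γ + 6) * two
  obtain ⟨r4, d4⟩ := r3.step_of_eq v3_5 (ι := γ ^ 12 + γ ^ 8 + γ ^ 7 + γ ^ 4 + γ + 1)
    (a' := γ ^ 10 + γ ^ 9 + γ ^ 8 + γ ^ 5 + γ ^ 4 + γ ^ 3 + γ ^ 2 + γ)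
    (σ' := γ ^ 10 + γ ^ 9 + γ ^ 8 + γ ^ 7 + γ ^ 6 + γ ^ 2 + 1)
    (by linear_combination (γ ^ 11 + γ ^ 8 + 2 * γ ^ 7 + 3 * γ ^ 6 + 3 * γ ^ 4 + 6 * γ ^ 3 +
      8 * γ ^ 2 + 5 * γ + 8) * hγ + (8 * γ ^ 12 + 10 * γ ^ 11 + 11 * γ ^ 10 + 11 * γ ^ 9 +
      13 * γ ^ 8 + 8 * γ ^ 7 + 11 * γ ^ 6 + 6 * γ ^ 5 + 11 * γ ^ 4 + 6 * γ ^ 3 + 8 * γ ^ 2 +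
      3 * γ + 4) * two)
    (by linear_combination (γ ^ 9 + γ ^ 8 + γ ^ 7 + γ ^ 6 + 3 * γ ^ 5 + 5 * γ ^ 4 + 4 * γ ^ 3 +
      5 * γ ^ 2 + 7 * γ + 14) * hγ + (7 * γ ^ 12 + 8 * γ ^ 11 + 10 * γ ^ 10 + 16 * γ ^ 9 +
      14 * γ ^ 8 + 8 * γ ^ 7 + 13 * γ ^ 6 + 7 * γ ^ 5 + 12 * γ ^ 4 + 5 * γ ^ 3 + 9 * γ ^ 2 +
      3 * γ + 7) * two)
    (by linear_combination (γ ^ 9 + γ ^ 8 + γ ^ 7 + 3 * γ ^ 5 + 5 * γ ^ 4 + 5 * γ ^ 3 +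
      3 * γ ^ 2 + 6 * γ + 13) * hγ + (7 * γ ^ 12 + 8 * γ ^ 11 + 9 * γ ^ 10 + 16 * γ ^ 9 +
      12 * γ ^ 8 + 8 * γ ^ 7 + 11 * γ ^ 6 + 8 * γ ^ 5 + 11 * γ ^ 4 + 6 * γ ^ 3 + 8 * γ ^ 2 +
      3 * γ + 6) * two)
  set L4 := artinSchreier (γ ^ 12 + γ ^ 9 + γ ^ 7 + γ ^ 4 + γ ^ 3 + 1) ∘ₗ L3
  have v4_8 : L4 (γ ^ 8) = γ ^ 12 + γ ^ 10 + γ ^ 7 + γ ^ 3 + γ ^ 2 + γ := by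
    rw [LinearMap.comp_apply, v3_8, artinSchreier_apply]
    linear_combination (2 * γ ^ 11 + 3 * γ ^ 10 + γ ^ 9 + γ ^ 8 + 6 * γ ^ 7 + 11 * γ ^ 6 +
      7 * γ ^ 5 + 5 * γ ^ 4 + 13 * γ ^ 3 + 25 * γ ^ 2 + 28 * γ + 26) * hγ + (18 * γ ^ 12 +
      29 * γ ^ 11 + 38 * γ ^ 10 + 43 * γ ^ 9 + 36 * γ ^ 8 + 27 * γ ^ 7 + 34 * γ ^ 6 + 25 * γ ^ 5 +
      29 * γ ^ 4 + 21 * γ ^ 3 + 26 * γ ^ 2 + 14 * γ + 13) * two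
  obtain ⟨r5, d5⟩ := r4.step_of_eq v4_8 (ι := γ ^ 11 + γ ^ 10 + γ ^ 9 + γ ^ 6 + γ ^ 4 + γ ^ 3 + γ + 1)
    (a' := γ ^ 12 + γ ^ 8 + γ ^ 7 + γ ^ 6 + γ ^ 3)
    (σ' := 0)
    (by linear_combination (γ ^ 10 + γ ^ 9 + 2 * γ ^ 8 + γ ^ 7 + 2 * γ ^ 6 + 4 * γ ^ 5 +
      4 * γ ^ 4 + 7 * γ ^ 3 + 5 * γ ^ 2 + 11 * γ + 15) * hγ + (10 * γ ^ 12 + 11 * γ ^ 11 +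
      14 * γ ^ 10 + 20 * γ ^ 9 + 15 * γ ^ 8 + 13 * γ ^ 7 + 14 * γ ^ 6 + 12 * γ ^ 5 + 13 * γ ^ 4 +
      10 * γ ^ 3 + 11 * γ ^ 2 + 6 * γ + 7) * two)
    (by linear_combination (γ ^ 9 + γ ^ 8 + 2 * γ ^ 7 + γ ^ 6 + 2 * γ ^ 5 + 4 * γ ^ 4 +
      5 * γ ^ 3 + 7 * γ ^ 2 + 6 * γ + 12) * hγ + (7 * γ ^ 12 + 11 * γ ^ 11 + 11 * γ ^ 10 +
      15 * γ ^ 9 + 13 * γ ^ 8 + 8 * γ ^ 7 + 13 * γ ^ 6 + 8 * γ ^ 5 + 13 * γ ^ 4 + 6 * γ ^ 3 +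
      10 * γ ^ 2 + 3 * γ + 6) * two)
    (by linear_combination (γ ^ 8 + 2 * γ ^ 7 + 3 * γ ^ 6 + 2 * γ ^ 5 + 2 * γ ^ 4 + 5 * γ ^ 3 +
      8 * γ ^ 2 + 11 * γ + 11) * hγ + (8 * γ ^ 12 + 11 * γ ^ 11 + 15 * γ ^ 10 + 18 * γ ^ 9 +
      15 * γ ^ 8 + 12 * γ ^ 7 + 14 * γ ^ 6 + 11 * γ ^ 5 + 12 * γ ^ 4 + 9 * γ ^ 3 + 11 * γ ^ 2 +
      6 * γ + 6) * two)
  exact ⟨_, _, r5, by rw [d5, d4, d3, d2, d1]⟩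

end

section
open Polynomial
variable {F : Type*} [Field F] [Fintype F] [DecidableEq F] [Algebra (ZMod 2) F]

theorem card_eq_two_pow_finrank (F : Type*) [Field F] [Fintype F] [Algebra (ZMod 2) F] :
    Fintype.card F = 2 ^ Module.finrank (ZMod 2) F := by
  rw [Module.card_eq_pow_finrank (K := ZMod 2), ZMod.card]

theorem traceSign_one (h : Odd (Module.finrank (ZMod 2) F)) : traceSign (1 : F) = -1 := by
  have : Algebra.trace (ZMod 2) F 1 = 1 := by
    rw [← map_one (algebraMap (ZMod 2) F), Algebra.trace_algebraMap, nsmul_one,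
      ZMod.natCast_eq_one_iff_odd.2 h]
  simp [traceSign, this]

theorem hasRecipSumZero_four_of_finrank_eq_nine (h : Module.finrank (ZMod 2) F = 9) :
    HasRecipSumZero F 4 := by
  obtain ⟨γ, hγ⟩ := exists_aeval_eq_zero_of_pow_card
    (p := (X ^ 9 - (X ^ 8 + X ^ 7 + X ^ 3 + X ^ 2 + X + 1) : F[X]))
    (by
      rw [show (X ^ 9 - (X ^ 8 + X ^ 7 + X ^ 3 + X ^ 2 + X + 1) : F[X]).degree = 9 by compute_degree!]
      decide)
    (fun x hx => by
      rw [card_eq_two_pow_finrank, h]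
      refine pow_two_pow_nine_eq ?_ ?_
      · rw [← map_ofNat (algebraMap F (AlgebraicClosure F)), two_eq_zero_of_algebra, map_zero]
      · simpa [sub_eq_zero] using hx)
  exact hasRecipSumZero_four_of_pow_nine (γ := γ) (by simpa [sub_eq_zero] using hγ)

theorem hasRecipSumZero_five_of_finrank_eq_thirteen (h : Module.finrank (ZMod 2) F = 13) :
    HasRecipSumZero F 5 := by
  obtain ⟨γ, hγ⟩ := exists_aeval_eq_zero_of_pow_card
    (p := (X ^ 13 - (X ^ 9 + X ^ 8 + X ^ 6 + X ^ 4 + X ^ 2 + 1) : F[X]))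
    (by
      rw [show (X ^ 13 - (X ^ 9 + X ^ 8 + X ^ 6 + X ^ 4 + X ^ 2 + 1) : F[X]).degree = 13 by
        compute_degree!]
      decide)
    (fun x hx => by
      rw [card_eq_two_pow_finrank, h]
      refine pow_two_pow_thirteen_eq ?_ ?_
      · rw [← map_ofNat (algebraMap F (AlgebraicClosure F)), two_eq_zero_of_algebra, map_zero]
      · simpa [sub_eq_zero] using hx)
  exact hasRecipSumZero_five_of_pow_thirteen (γ := γ) (by simpa [sub_eq_zero] using hγ)

theorem nontrivial_units_of_two_le_finrank (hn : 2 ≤ Module.finrank (ZMod 2) F) :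
    Nontrivial Fˣ := by
  rw [← Finite.one_lt_card_iff_nontrivial, Nat.card_units, Nat.card_eq_fintype_card,
    card_eq_two_pow_finrank]
  have : 2 ^ 2 ≤ 2 ^ Module.finrank (ZMod 2) F := Nat.pow_le_pow_right (by norm_num) hn
  omega

theorem hasRecipSumZero_of_three_mul_lt (hn : 8 ≤ Module.finrank (ZMod 2) F) (k : ℕ) (h3 : 3 ≤ k)
    (hk : 3 * (k - 3) < Module.finrank (ZMod 2) F) : HasRecipSumZero F k := by
  have hnt := nontrivial_units_of_two_le_finrank (F := F) (by omega)
  have hcard := card_eq_two_pow_finrank F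
  have hle : ∀ m, m ≤ Module.finrank (ZMod 2) F → 2 ^ m ≤ Fintype.card F := fun m hm =>
    hcard ▸ Nat.pow_le_pow_right (by norm_num) hm
  have three : HasRecipSumZero F 3 := hasRecipSumZero_three (hle 8 hn)
  have four : HasRecipSumZero F 4 := by
    rcases Nat.even_or_odd (Module.finrank (ZMod 2) F) with he | ho
    · have two := hasRecipSumZero_of_dvd le_rfl he.two_dvd
      exact two.add two (by omega)
    · by_cases h9 : Module.finrank (ZMod 2) F = 9
      · exact hasRecipSumZero_four_of_finrank_eq_nine h9
      · obtain ⟨m, hm⟩ := ho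
        exact hasRecipSumZero_four (traceSign_one ⟨m, hm⟩) (hle 11 (by omega))
  have five : HasRecipSumZero F 5 := by
    rcases Nat.even_or_odd (Module.finrank (ZMod 2) F) with he | ho
    · exact (hasRecipSumZero_of_dvd le_rfl he.two_dvd).add three (by omega)
    · have hcases : Module.finrank (ZMod 2) F = 9 ∨ Module.finrank (ZMod 2) F = 11 ∨
          Module.finrank (ZMod 2) F = 13 ∨ Module.finrank (ZMod 2) F = 15 ∨
          17 ≤ Module.finrank (ZMod 2) F := by
        obtain ⟨m, hm⟩ := ho
        omega
      rcases hcases with h | h | h | h | h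
      · simpa [h] using four.dual
      · simpa [h] using (three.add three (by omega)).dual
      · exact hasRecipSumZero_five_of_finrank_eq_thirteen h
      · exact hasRecipSumZero_of_dvd (by norm_num) (by rw [h]; norm_num)
      · exact hasRecipSumZero_five (traceSign_one ho) (hle 17 h)
  induction k using Nat.strong_induction_on with
  | _ k ih =>
    by_cases h6 : 6 ≤ k
    · have := (ih (k - 3) (by omega) (by omega) (by omega)).add three (by omega)
      rwa [Nat.sub_add_cancel h3] at this
    · interval_cases k <;> assumption

theorem HasRecipSumZero.exists_submodule {k : ℕ} (h : HasRecipSumZero F k) :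
    ∃ (E : Submodule (ZMod 2) F) (v : F), Module.finrank (ZMod 2) E = k ∧
      ∑ᶠ u : E, (v + (u : F))⁻¹ = 0 := by
  obtain ⟨L, a, hL, hk⟩ := h
  refine ⟨LinearMap.ker L, 0, hk, ?_⟩
  simp only [zero_add]
  rw [← hL.ker_sum]
  refine (finsum_set_coe_eq_finsum_mem (f := fun x : F => x⁻¹) (LinearMap.ker L : Set F)).trans ?_
  rw [← finsum_mem_coe_finset]
  simp

end


/-- Let `n ≥ 8` and let `k` satisfy `3 ≤ k ≤ ⌈n/3⌉ + 2` or `⌊2n/3⌋ − 2 ≤ k ≤ n − 3`.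
Then the multiplicative inverse function `f_inv(x) = x⁻¹` (with `f_inv(0) = 0`) on
`F_{2^n}` is not `k`th order sum-free: there is a `k`-dimensional `F₂`-affine subspace
`A = v + E` of `F_{2^n}` with `∑_{x ∈ A} f_inv(x) = 0`. -/
theorem inv_not_sum_free_of_small_or_large_k (n k : ℕ) (hn : 8 ≤ n)
    (hk : (3 ≤ k ∧ (k : ℤ) ≤ ⌈(n : ℚ) / 3⌉ + 2) ∨
          (⌊2 * (n : ℚ) / 3⌋ - 2 ≤ (k : ℤ) ∧ (k : ℤ) ≤ (n : ℤ) - 3)) :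
    ∃ (E : Submodule (ZMod 2) (GaloisField 2 n)) (v : GaloisField 2 n),
      Module.finrank (ZMod 2) E = k ∧
      ∑ᶠ u : E, (v + (u : GaloisField 2 n))⁻¹ = 0 := by
  have : Fintype (GaloisField 2 n) := Fintype.ofFinite _
  classical
  have hn' : Module.finrank (ZMod 2) (GaloisField 2 n) = n := GaloisField.finrank 2 (by omega)
  have hnt := nontrivial_units_of_two_le_finrank (F := GaloisField 2 n) (by omega)
  refine HasRecipSumZero.exists_submodule ?_
  rcases hk with ⟨h3, hk⟩ | ⟨hk, h3⟩
  · refine hasRecipSumZero_of_three_mul_lt (by omega) k h3 ?_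
    have h : ((k - 3 : ℤ) : ℚ) < n / 3 := Int.lt_ceil.1 (by omega)
    rw [lt_div_iff₀ (by norm_num)] at h
    have : ((k : ℤ) - 3) * 3 < n := by exact_mod_cast h
    omega
  · have h : 2 * (n : ℚ) / 3 < ((k + 3 : ℤ) : ℚ) := Int.floor_lt.1 (by omega)
    rw [div_lt_iff₀ (by norm_num)] at h
    have : 2 * (n : ℤ) < (k + 3) * 3 := by exact_mod_cast h
    have := (hasRecipSumZero_of_three_mul_lt (F := GaloisField 2 n) (by omega) (n - k) (by omega)
      (by omega)).dual
    rwa [hn', Nat.sub_sub_self (by omega)] at this
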